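/- arXiv:1703.03069 — 11 statements merged into one kernel-verified Lean document; each statement's English description precedes it below -/
import Mathlib

section
/- (Mean value inequality) Let ψ : [0,1] → (−∞,+∞] be lower semicontinuous on [0,1] and finite at 0. Then for every real number λ with λ ≤ ψ(1) − ψ(0) there exists t₀ ∈ [0,1) such that ψ(t₀) ≤ ψ(0) + t₀·λ and λ ≤ ψ^r(t₀;+1). -/
open Filter Topology Set

noncomputable section

variable {X : Type*} [NormedAddCommGroup X] [NormedSpace ℝ X]

/-- The difference quotient `(f(x + t·u) − f(x))/t` as an extended real. -/
def erSlope (f : X → EReal) (x u : X) (t : ℝ) : EReal :=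
  (f (x + t • u) - f x) * ((t⁻¹ : ℝ) : EReal)

/-- The (lower right Dini) radial subderivative `f^r(x;u)`. -/
def radialSub (f : X → EReal) (x u : X) : EReal :=
  Filter.liminf (erSlope f x u) (𝓝[>] (0:ℝ))

/-- The upper radial subderivative `f^r_+(x;u)`. -/
def radialSubPlus (f : X → EReal) (x u : X) : EReal :=
  Filter.limsup (erSlope f x u) (𝓝[>] (0:ℝ))

/-- The (lower right Dini-Hadamard) directional subderivative `f^d(x;u)`. -/
def dirSub (f : X → EReal) (x u : X) : EReal :=
  Filter.liminf (fun p : ℝ × X => (f (x + p.1 • p.2) - f x) * ((p.1⁻¹ : ℝ) : EReal))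
    ((𝓝[>] (0:ℝ)) ×ˢ 𝓝 u)

/-- The Clarke-Rockafellar subderivative `f^↑(x;u)`. -/
def crSub (f : X → EReal) (x u : X) : EReal :=
  ⨆ δ ∈ Set.Ioi (0:ℝ),
    Filter.limsup
      (fun p : X × ℝ =>
        ⨅ u' ∈ Metric.ball u δ, (f (p.1 + p.2 • u') - f p.1) * ((p.2⁻¹ : ℝ) : EReal))
      ((𝓝 x ⊓ Filter.comap f (𝓝 (f x))) ×ˢ 𝓝[>] (0:ℝ))

/-- The Clarke subderivative `f^0(x;u)`. -/
def clarkeSub (f : X → EReal) (x u : X) : EReal :=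
  Filter.limsup (fun p : X × ℝ => (f (p.1 + p.2 • u) - f p.1) * ((p.2⁻¹ : ℝ) : EReal))
    (𝓝 x ×ˢ 𝓝[>] (0:ℝ))

/-- The directional limsup `limsup_{x →_v xbar} h(x) :=
`lim_{δ↘0} sup { h(xbar + t v') : 0 < t < δ, ‖v' − v‖ < δ }`. -/
def dirLimsup (h : X → EReal) (x v : X) : EReal :=
  ⨅ δ ∈ Set.Ioi (0:ℝ), ⨆ t ∈ Set.Ioo (0:ℝ) δ, ⨆ v' ∈ Metric.ball v δ, h (x + t • v')

/-- The ordinary limsup `limsup_{x → xbar} h(x) := lim_{δ↘0} sup { h(x) : 0 < ‖x − xbar‖ < δ }`. -/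
def ptLimsup (h : X → EReal) (x : X) : EReal :=
  ⨅ δ ∈ Set.Ioi (0:ℝ), ⨆ y ∈ {y : X | 0 < ‖y - x‖ ∧ ‖y - x‖ < δ}, h y

/-- `f` is upper semismooth at `x` in the direction `u`. -/
def UpperSemismooth (f : X → EReal) (x u : X) : Prop :=
  ⨅ α ∈ Set.Ici (0:ℝ), dirLimsup (fun y => radialSub f y (u + α • (x - y))) x u
    ≤ radialSub f x u

/-- `f` is strictly upper semismooth at `x` in the direction `u`. -/
def StrictUpperSemismooth (f : X → EReal) (x u : X) : Prop :=
  ⨅ α ∈ Set.Ici (0:ℝ), ptLimsup (fun y => radialSub f y (u + α • (x - y))) x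
    ≤ radialSub f x u

/-- `f` is radially accessible at `x` from the direction `u`. -/
def RadiallyAccessible (f : X → EReal) (x u : X) : Prop :=
  f x = Filter.liminf (fun t : ℝ => f (x + t • u)) (𝓝[>] (0:ℝ))

/-- A proper lower semicontinuous function `X → (−∞,+∞]`. -/
def ProperLsc (f : X → EReal) : Prop :=
  LowerSemicontinuous f ∧ (∃ x, f x ≠ ⊤) ∧ ∀ x, f x ≠ ⊥

/-- Convexity for extended-real-valued functions. -/
def ERealConvexOn (f : X → EReal) : Prop :=
  ∀ x y : X, ∀ a b : ℝ, 0 ≤ a → 0 ≤ b → a + b = 1 →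
    f (a • x + b • y) ≤ (a : EReal) * f x + (b : EReal) * f y

/-- `f` is (finite and) Lipschitz near `x`. -/
def ERealLipschitzNear (f : X → EReal) (x : X) : Prop :=
  ∃ (K ε : ℝ), 0 < ε ∧ (∀ y ∈ Metric.ball x ε, f y ≠ ⊤ ∧ f y ≠ ⊥) ∧
    ∀ y ∈ Metric.ball x ε, ∀ z ∈ Metric.ball x ε,
      f y ≤ f z + ((K * ‖y - z‖ : ℝ) : EReal)

/-- The Moreau-Rockafellar subdifferential. -/
def mrSubdiff (f : X → EReal) (x : X) : Set (X →L[ℝ] ℝ) :=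
  {p | ∀ y : X, ((p (y - x) : ℝ) : EReal) + f x ≤ f y}

/-- The Clarke subdifferential, associated to the Clarke-Rockafellar subderivative. -/
def clarkeSubdiff (f : X → EReal) (x : X) : Set (X →L[ℝ] ℝ) :=
  {p | ∀ u : X, ((p u : ℝ) : EReal) ≤ crSub f x u}

/-- The set `∂̂f(xbar)` of weak* limits of nets of subgradients at nearby points
(nets being encoded by filters on the product `X × X*`). -/
def hatSubdiff (S : X → Set (X →L[ℝ] ℝ)) (f : X → EReal) (x : X) : Set (X →L[ℝ] ℝ) :=
  {p | ∃ l : Filter (X × (X →L[ℝ] ℝ)), l.NeBot ∧ (∀ᶠ q in l, q.2 ∈ S q.1) ∧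
        Filter.Tendsto (fun q : X × (X →L[ℝ] ℝ) => q.1) l (𝓝 x) ∧
        Filter.Tendsto (fun q : X × (X →L[ℝ] ℝ) => f q.1) l (𝓝 (f x)) ∧
        (∀ w : X, Filter.Tendsto (fun q : X × (X →L[ℝ] ℝ) => q.2 w) l (𝓝 (p w))) ∧
        Filter.limsup (fun q : X × (X →L[ℝ] ℝ) => ((q.2 (q.1 - x) : ℝ) : EReal)) l ≤ 0}

/-- A subdifferential: an operator `∂` with `∂_MR f ⊆ ∂f ⊆ ∂_C f` for every proper lsc `f`,
satisfying the Separation Principle (SP). -/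
structure Subdifferential (X : Type*) [NormedAddCommGroup X] [NormedSpace ℝ X] where
  sub : (X → EReal) → X → Set (X →L[ℝ] ℝ)
  mr_subset : ∀ f : X → EReal, ProperLsc f → ∀ x, mrSubdiff f x ⊆ sub f x
  subset_clarke : ∀ f : X → EReal, ProperLsc f → ∀ x, sub f x ⊆ clarkeSubdiff f x
  separation : ∀ (f φ : X → EReal) (x : X), ProperLsc f → ProperLsc φ →
    ERealConvexOn φ → ERealLipschitzNear φ x → f x ≠ ⊤ →
    (∀ᶠ y in 𝓝 x, f x + φ x ≤ f y + φ y) →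
    ∃ p₁ ∈ hatSubdiff (sub f) f x, ∃ p₂ ∈ sub φ x, p₁ + p₂ = 0

/-- The subderivative associated to a subdifferential: the support function
`f^∂(x;u) := sup {⟨x*, u⟩ : x* ∈ ∂f(x)}`. -/
def supportSub (S : X → Set (X →L[ℝ] ℝ)) (x u : X) : EReal :=
  ⨆ p ∈ S x, ((p u : ℝ) : EReal)

/-- Lower right Dini derivative `ψ^r(t₀;+1)` of `ψ : ℝ → [−∞,+∞]`. -/
def diniLower (ψ : ℝ → EReal) (t₀ : ℝ) : EReal :=
  Filter.liminf (fun t : ℝ => (ψ (t₀ + t) - ψ t₀) * ((t⁻¹ : ℝ) : EReal)) (𝓝[>] (0:ℝ))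

/-- Upper right Dini derivative `ψ^r_+(t₀;+1)` of `ψ : ℝ → [−∞,+∞]`. -/
def diniUpper (ψ : ℝ → EReal) (t₀ : ℝ) : EReal :=
  Filter.limsup (fun t : ℝ => (ψ (t₀ + t) - ψ t₀) * ((t⁻¹ : ℝ) : EReal)) (𝓝[>] (0:ℝ))

end

/-- If the graph of `ψ` lies above the line of slope `lam` through the finite point
`(t₀, ψ t₀)` on `[t₀, b]`, with `t₀ < b`, then `lam` bounds the lower Dini derivative below. -/
theorem le_diniLower_of_forall_le {ψ : ℝ → EReal} {t₀ b lam : ℝ} (hb : t₀ < b)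
    (hbot : ψ t₀ ≠ ⊥) (htop : ψ t₀ ≠ ⊤)
    (h : ∀ t ∈ Set.Icc t₀ b, ψ t₀ + ((lam * (t - t₀) : ℝ) : EReal) ≤ ψ t) :
    (lam : EReal) ≤ diniLower ψ t₀ := by
  refine le_liminf_of_le (by isBoundedDefault) ?_
  filter_upwards [Ioc_mem_nhdsGT (sub_pos.2 hb)] with t ht
  have h1 := h (t₀ + t) ⟨by linarith [ht.1], by linarith [ht.2]⟩
  rw [add_sub_cancel_left, add_comm,
    ← EReal.le_sub_iff_add_le (Or.inl hbot) (Or.inl htop)] at h1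
  calc (lam : EReal) = ((lam * t : ℝ) : EReal) * ((t⁻¹ : ℝ) : EReal) := by
        rw [← EReal.coe_mul, mul_inv_cancel_right₀ ht.1.ne']
    _ ≤ _ := mul_le_mul_of_nonneg_right h1 (EReal.coe_nonneg.2 (inv_nonneg.2 ht.1.le))

/-- **Mean value inequality.** -/
theorem mean_value_inequality (ψ : ℝ → EReal)
    (hbot : ∀ t ∈ Set.Icc (0:ℝ) 1, ψ t ≠ ⊥)
    (hlsc : LowerSemicontinuousOn ψ (Set.Icc (0:ℝ) 1))
    (hfin : ψ 0 ≠ ⊤)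
    (lam : ℝ) (hlam : (lam : EReal) ≤ ψ 1 - ψ 0) :
    ∃ t₀ ∈ Set.Ico (0:ℝ) 1,
      ψ t₀ ≤ ψ 0 + ((t₀ * lam : ℝ) : EReal) ∧ (lam : EReal) ≤ diniLower ψ t₀ := by
  obtain ⟨a, ha⟩ : ∃ a : ℝ, ψ 0 = a :=
    ⟨_, (EReal.coe_toReal hfin (hbot 0 (by simp))).symm⟩
  have hg : LowerSemicontinuousOn (fun t => ψ t + ((-(t * lam) : ℝ) : EReal)) (Set.Icc 0 1) := by
    refine hlsc.add' ((Continuous.lowerSemicontinuous ?_).lowerSemicontinuousOn _) fun t _ =>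
      EReal.continuousAt_add (Or.inr (EReal.coe_ne_bot _)) (Or.inr (EReal.coe_ne_top _))
    exact continuous_coe_real_ereal.comp (by fun_prop)
  obtain ⟨m, hm, hmin⟩ : ∃ m ∈ Set.Ico (0:ℝ) 1,
      IsMinOn (fun t => ψ t + ((-(t * lam) : ℝ) : EReal)) (Set.Icc 0 1) m := by
    obtain ⟨m, hm, hmin⟩ := hg.exists_isMinOn (by simp) isCompact_Icc
    rcases hm.2.lt_or_eq with hlt | rfl
    · exact ⟨m, ⟨hm.1, hlt⟩, hmin⟩
    refine ⟨0, by simp, isMinOn_iff.2 fun t ht => le_trans ?_ (hmin ht)⟩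
    rw [EReal.le_sub_iff_add_le (by simp [ha]) (by simp [ha]), ha] at hlam
    calc ψ 0 + ((-(0 * lam) : ℝ) : EReal)
        = ((lam : EReal) + a) + ((-(1 * lam) : ℝ) : EReal) := by
          rw [ha]; norm_cast; ring
      _ ≤ _ := add_le_add_left hlam _
  have hmI : m ∈ Set.Icc (0:ℝ) 1 := Set.Ico_subset_Icc_self hm
  have hshift : ∀ t ∈ Set.Icc (0:ℝ) 1, ψ m ≤ ψ t + ((lam * (m - t) : ℝ) : EReal) := by
    intro t ht
    have h := add_le_add_left (hmin ht) ((m * lam : ℝ) : EReal)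
    simp only [add_assoc, ← EReal.coe_add] at h
    convert h using 2
    · simp
    · congr 1; ring
  have hle : ψ m ≤ ψ 0 + ((m * lam : ℝ) : EReal) := by
    simpa [mul_comm] using hshift 0 (by simp)
  have htop : ψ m ≠ ⊤ := by
    rw [ha, ← EReal.coe_add] at hle
    exact ne_top_of_le_ne_top (EReal.coe_ne_top _) hle
  refine ⟨m, hm, hle, le_diniLower_of_forall_le hm.2 (hbot m hmI) htop fun t ht => ?_⟩
  have h := add_le_add_left (hshift t ⟨hm.1.trans ht.1, ht.2⟩) ((lam * (t - m) : ℝ) : EReal)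
  rwa [add_assoc, ← EReal.coe_add, ← mul_add, sub_add_sub_cancel', sub_self, mul_zero,
    EReal.coe_zero, add_zero] at h
end

section
/- (Mean value theorem, semicontinuous version) Let φ : [0,1] → (−∞,+∞] be lower semicontinuous on [0,1] and finite at 0, and let γ : [0,1] → [−∞,+∞) be upper semicontinuous on [0,1] and finite at 0. Assume that for every t ∈ [0,1) there exists a real number ρ(t) such that φ^r(t;+1) ≤ ρ(t) ≤ γ^r(t;+1). Then φ(1) − φ(0) ≤ γ(1) − γ(0) (inequality in the extended reals). -/
open Filter Topology Set

/-- If the difference quotient from `a` to `x ≠ ⊥` over a step `s > 0` is below a real `r`,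
then `x` is finite and lies below the line of slope `r` through `a`. -/
lemma toReal_lt_of_slope_lt {x : EReal} {a r s : ℝ} (hs : 0 < s) (hx : x ≠ ⊥)
    (h : (x - (a : EReal)) * ((s⁻¹ : ℝ) : EReal) < (r : EReal)) :
    x ≠ ⊤ ∧ x.toReal < a + r * s := by
  have hs' : 0 < s⁻¹ := inv_pos.2 hs
  induction x with
  | bot => exact absurd rfl hx
  | top =>
    rw [EReal.top_sub_coe, EReal.top_mul_coe_of_pos hs'] at h
    exact absurd h not_top_lt
  | coe x =>
    refine ⟨EReal.coe_ne_top x, ?_⟩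
    rw [← EReal.coe_sub, ← EReal.coe_mul, EReal.coe_lt_coe_iff, ← div_eq_mul_inv,
      div_lt_iff₀ hs] at h
    rw [EReal.toReal_coe]
    linarith

/-- If the difference quotient from `a` to `x ≠ ⊤` over a step `s > 0` is above a real `r`,
then `x` is finite and lies above the line of slope `r` through `a`. -/
lemma lt_toReal_of_lt_slope {x : EReal} {a r s : ℝ} (hs : 0 < s) (hx : x ≠ ⊤)
    (h : (r : EReal) < (x - (a : EReal)) * ((s⁻¹ : ℝ) : EReal)) :
    x ≠ ⊥ ∧ a + r * s < x.toReal := by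
  have hs' : 0 < s⁻¹ := inv_pos.2 hs
  induction x with
  | top => exact absurd rfl hx
  | bot =>
    rw [EReal.bot_sub, EReal.bot_mul_coe_of_pos hs'] at h
    exact absurd h not_lt_bot
  | coe x =>
    refine ⟨EReal.coe_ne_bot x, ?_⟩
    rw [← EReal.coe_sub, ← EReal.coe_mul, EReal.coe_lt_coe_iff, ← div_eq_mul_inv,
      lt_div_iff₀ hs] at h
    rw [EReal.toReal_coe]
    linarith

/-- If `φ` and `γ` are finite at `t < 1` and a real number separates their lower right Dini
derivatives, then `φ - γ` grows at rate at most `ε` up to some point of `(t, 1)`. -/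
lemma exists_step_of_diniLower_le {φ γ : ℝ → EReal} {t a b ρ ε : ℝ} (ht : t ∈ Set.Ico (0:ℝ) 1)
    (hφbot : ∀ t ∈ Set.Icc (0:ℝ) 1, φ t ≠ ⊥) (hγtop : ∀ t ∈ Set.Icc (0:ℝ) 1, γ t ≠ ⊤)
    (ha : φ t = a) (hb : γ t = b) (hφ : diniLower φ t ≤ ρ) (hγ : ρ ≤ diniLower γ t)
    (hε : 0 < ε) :
    ∃ u ∈ Set.Ioo t 1, ∃ a' b' : ℝ, φ u = a' ∧ γ u = b' ∧ a' - b' ≤ a - b + ε * (u - t) := by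
  have h₁ : diniLower φ t < ((ρ + ε / 2 : ℝ) : EReal) :=
    hφ.trans_lt (EReal.coe_lt_coe_iff.2 (by linarith))
  have h₂ : ((ρ - ε / 2 : ℝ) : EReal) < diniLower γ t :=
    (EReal.coe_lt_coe_iff.2 (by linarith)).trans_le hγ
  have hs : ∀ᶠ s : ℝ in 𝓝[>] 0, s ∈ Set.Ioo 0 (1 - t) :=
    Ioo_mem_nhdsGT (by linarith [ht.2])
  obtain ⟨s, ⟨hs₁, hs₂⟩, hs⟩ :=
    ((Filter.frequently_lt_of_liminf_lt (by isBoundedDefault) h₁).and_eventually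
      (Filter.eventually_lt_of_lt_liminf h₂ (by isBoundedDefault))).and_eventually hs |>.exists
  have hu : t + s ∈ Set.Icc (0:ℝ) 1 := ⟨by linarith [ht.1, hs.1], by linarith [hs.2]⟩
  rw [ha] at hs₁
  rw [hb] at hs₂
  obtain ⟨hφt, hφs⟩ := toReal_lt_of_slope_lt hs.1 (hφbot _ hu) hs₁
  obtain ⟨hγb, hγs⟩ := lt_toReal_of_lt_slope hs.1 (hγtop _ hu) hs₂
  refine ⟨t + s, ⟨by linarith [hs.1], by linarith [hs.2]⟩, _, _,
    (EReal.coe_toReal hφt (hφbot _ hu)).symm, (EReal.coe_toReal (hγtop _ hu) hγb).symm, ?_⟩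
  linarith

/-- A difference of a lower semicontinuous `φ > ⊥` and an upper semicontinuous `γ < ⊤`, corrected
by a linear term, is lower semicontinuous. -/
lemma lowerSemicontinuousOn_sub_sub_linear {φ γ : ℝ → EReal} {s : Set ℝ} (ε : ℝ)
    (hφbot : ∀ t ∈ s, φ t ≠ ⊥) (hγtop : ∀ t ∈ s, γ t ≠ ⊤)
    (hφ : LowerSemicontinuousOn φ s) (hγ : UpperSemicontinuousOn γ s) :
    LowerSemicontinuousOn (fun t => φ t + -γ t + ((-(ε * t) : ℝ) : EReal)) s := by
  have hneg : LowerSemicontinuousOn (fun t => -γ t) s :=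
    continuous_neg.comp_upperSemicontinuousOn_antitone hγ fun _ _ h => EReal.neg_le_neg_iff.2 h
  have hlin : LowerSemicontinuousOn (fun t : ℝ => ((-(ε * t) : ℝ) : EReal)) s :=
    (continuous_coe_real_ereal.comp (by fun_prop : Continuous fun t : ℝ => -(ε * t)))
      |>.lowerSemicontinuous.lowerSemicontinuousOn s
  refine (hφ.add' hneg fun t ht => ?_).add' hlin fun t ht => ?_
  · exact EReal.continuousAt_add (Or.inr (by simpa using hγtop t ht)) (Or.inl (hφbot t ht))
  · exact EReal.continuousAt_add (Or.inr (EReal.coe_ne_bot _)) (Or.inr (EReal.coe_ne_top _))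

/-- **Mean value theorem, semicontinuous version.** -/
theorem mean_value_semicontinuous (φ γ : ℝ → EReal)
    (hφbot : ∀ t ∈ Set.Icc (0:ℝ) 1, φ t ≠ ⊥)
    (hγtop : ∀ t ∈ Set.Icc (0:ℝ) 1, γ t ≠ ⊤)
    (hφlsc : LowerSemicontinuousOn φ (Set.Icc (0:ℝ) 1)) (hφ0 : φ 0 ≠ ⊤)
    (hγusc : UpperSemicontinuousOn γ (Set.Icc (0:ℝ) 1)) (hγ0 : γ 0 ≠ ⊥)
    (hρ : ∀ t ∈ Set.Ico (0:ℝ) 1, ∃ ρ : ℝ,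
      diniLower φ t ≤ (ρ : EReal) ∧ (ρ : EReal) ≤ diniLower γ t) :
    φ 1 - φ 0 ≤ γ 1 - γ 0 := by
  have h01 : (0:ℝ) ∈ Set.Icc (0:ℝ) 1 := ⟨le_rfl, zero_le_one⟩
  obtain ⟨a₀, ha₀⟩ : ∃ a : ℝ, φ 0 = a := ⟨_, (EReal.coe_toReal hφ0 (hφbot 0 h01)).symm⟩
  obtain ⟨b₀, hb₀⟩ : ∃ b : ℝ, γ 0 = b := ⟨_, (EReal.coe_toReal (hγtop 0 h01) hγ0).symm⟩
  have key : ∀ ε : ℝ, 0 < ε → ∃ a b : ℝ, φ 1 = a ∧ γ 1 = b ∧ a - b ≤ a₀ - b₀ + ε := by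
    intro ε hε
    obtain ⟨v, hv, hSv⟩ := lowerSemicontinuousOn_iff_preimage_Iic.1
      (lowerSemicontinuousOn_sub_sub_linear ε hφbot hγtop hφlsc hγusc)
      ((a₀ - b₀ : ℝ) : EReal)
    have mem_iff : ∀ t ∈ Set.Icc (0:ℝ) 1,
        t ∈ v ↔ ∃ a b : ℝ, φ t = a ∧ γ t = b ∧ a - b ≤ a₀ - b₀ + ε * t := by
      intro t ht
      have h := Set.ext_iff.1 hSv t
      simp only [Set.mem_inter_iff, ht, true_and, Set.mem_preimage, Set.mem_Iic] at h
      rw [← h]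
      have hφt := hφbot t ht
      have hγt := hγtop t ht
      generalize φ t = x at hφt ⊢
      generalize γ t = y at hγt ⊢
      induction x with
      | bot => exact absurd rfl hφt
      | top =>
        induction y with
        | top => exact absurd rfl hγt
        | bot => simp [-EReal.coe_sub, -EReal.coe_neg]
        | coe y => simp [-EReal.coe_sub, -EReal.coe_neg, ← EReal.coe_neg y]
      | coe x =>
        induction y with
        | top => exact absurd rfl hγt
        | bot => simp [-EReal.coe_sub, -EReal.coe_neg]
        | coe y =>
          simp only [← EReal.coe_neg, ← EReal.coe_add, EReal.coe_le_coe_iff, EReal.coe_eq_coe_iff,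
            exists_and_left, exists_eq_left']
          constructor <;> intro h <;> linarith
    have hne : (Set.Icc (0:ℝ) 1 ∩ v).Nonempty :=
      ⟨0, h01, (mem_iff 0 h01).2 ⟨a₀, b₀, ha₀, hb₀, by simp⟩⟩
    obtain ⟨t, ⟨ht, htv⟩, hmax⟩ := (isCompact_Icc.inter_right hv).exists_isGreatest hne
    obtain ⟨a, b, ha, hb, hab⟩ := (mem_iff t ht).1 htv
    obtain rfl | hlt := ht.2.eq_or_lt
    · exact ⟨a, b, ha, hb, by simpa using hab⟩
    obtain ⟨ρ, hρφ, hργ⟩ := hρ t ⟨ht.1, hlt⟩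
    obtain ⟨u, hu, a', b', ha', hb', hab'⟩ :=
      exists_step_of_diniLower_le ⟨ht.1, hlt⟩ hφbot hγtop ha hb hρφ hργ hε
    have hu01 : u ∈ Set.Icc (0:ℝ) 1 := ⟨ht.1.trans hu.1.le, hu.2.le⟩
    have huv : u ∈ v := (mem_iff u hu01).2 ⟨a', b', ha', hb', by linarith⟩
    exact absurd (hmax ⟨hu01, huv⟩) (not_le.2 hu.1)
  obtain ⟨a, b, ha, hb, -⟩ := key 1 one_pos
  have hab : a - b ≤ a₀ - b₀ := le_of_forall_pos_le_add fun ε hε => by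
    obtain ⟨a', b', ha', hb', h⟩ := key ε hε
    rw [ha, EReal.coe_eq_coe_iff] at ha'
    rw [hb, EReal.coe_eq_coe_iff] at hb'
    rwa [ha', hb']
  rw [ha, hb, ha₀, hb₀, ← EReal.coe_sub, ← EReal.coe_sub, EReal.coe_le_coe_iff]
  linarith
end

section
/- (Density of subdifferentials) Let X be a real Banach space, let ∂ be a subdifferential (an operator satisfying ∂_MR f ⊆ ∂f ⊆ ∂_C f and the Separation Principle), let f : X → (−∞,+∞] be proper lower semicontinuous, and let x̄ ∈ dom f. Then there exists a sequence ((xₙ, xₙ*)) with xₙ* ∈ ∂f(xₙ) for every n, such that xₙ → x̄, f(xₙ) → f(x̄), and limsupₙ ⟨xₙ*, xₙ − x̄⟩ ≤ 0. -/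
open Filter Topology Set

/-- **Ekeland's variational principle** for real-valued lower semicontinuous functions. -/
theorem LowerSemicontinuous.exists_ekeland {α : Type*} [MetricSpace α] [CompleteSpace α]
    {g : α → ℝ} (hg : LowerSemicontinuous g) (hb : BddBelow (range g)) (x₀ : α)
    {c : ℝ} (hc : 0 < c) :
    ∃ x, g x + c * dist x x₀ ≤ g x₀ ∧ ∀ y, g x ≤ g y + c * dist y x := by
  have htrans : ∀ {x y z : α}, g y + c * dist y x ≤ g x → g z + c * dist z y ≤ g y →
      g z + c * dist z x ≤ g x := by
    intro x y z h₁ h₂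
    have := mul_le_mul_of_nonneg_left (dist_triangle z y x) hc.le
    linarith
  have hnext : ∀ (x : α) (n : ℕ), ∃ y, g y + c * dist y x ≤ g x ∧
      ∀ z, g z + c * dist z y ≤ g y → g y ≤ g z + c * (1 / 2) ^ n := by
    intro x n
    have hne : (g '' {y | g y + c * dist y x ≤ g x}).Nonempty := ⟨g x, x, by simp, rfl⟩
    have hδ : 0 < c * (1 / 2 : ℝ) ^ n := by positivity
    obtain ⟨_, ⟨y, hy, rfl⟩, hlt⟩ := Real.lt_sInf_add_pos hne hδ
    refine ⟨y, hy, fun z hz => ?_⟩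
    have hzx : z ∈ {y | g y + c * dist y x ≤ g x} := htrans hy hz
    have := csInf_le (hb.mono (image_subset_range g _)) (mem_image_of_mem g hzx)
    linarith
  choose next hle hinf using hnext
  let u : ℕ → α := fun n => Nat.rec x₀ (fun k x => next x k) n
  have hu : ∀ n m, n ≤ m → g (u m) + c * dist (u m) (u n) ≤ g (u n) := by
    intro n m hnm
    induction m, hnm using Nat.le_induction with
    | base => simp
    | succ m _ ih => exact htrans ih (hle (u m) m)
  have hclose : ∀ n z, g z + c * dist z (u (n + 1)) ≤ g (u (n + 1)) →
      dist z (u (n + 1)) ≤ (1 / 2) ^ n := by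
    intro n z hz
    have := hinf (u n) n z hz
    refine le_of_mul_le_mul_left (a := c) ?_ hc
    change g (u (n + 1)) ≤ _ at this
    linarith
  have hpow : Tendsto (fun n : ℕ => (1 / 2 : ℝ) ^ n) atTop (𝓝 0) :=
    tendsto_pow_atTop_nhds_zero_of_lt_one (by norm_num) (by norm_num)
  have hcauchy : CauchySeq fun n => u (n + 1) :=
    cauchySeq_of_le_tendsto_0' _ (fun n m hnm => by
      rw [dist_comm]
      exact hclose n _ (hu (n + 1) (m + 1) (by lia))) hpow
  obtain ⟨x, hx⟩ := cauchySeq_tendsto_of_complete hcauchy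
  have hlim : ∀ n, g x + c * dist x (u n) ≤ g (u n) := by
    intro n
    have hlsc : LowerSemicontinuous fun y => g y + c * dist y (u n) :=
      hg.add (Continuous.lowerSemicontinuous (by fun_prop))
    refine (hlsc.isClosed_preimage (g (u n))).mem_of_tendsto hx ?_
    filter_upwards [eventually_ge_atTop n] with m hm
    exact hu n (m + 1) (by lia)
  refine ⟨x, hlim 0, fun y => ?_⟩
  by_contra! hy
  have hyx : y = x := by
    refine tendsto_nhds_unique (tendsto_iff_dist_tendsto_zero.2 ?_) hx
    refine squeeze_zero (fun _ => dist_nonneg) (fun n => ?_) hpow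
    rw [dist_comm]
    exact hclose n y (htrans (hlim (n + 1)) hy.le)
  simp [hyx] at hy

section Norm

variable {X : Type*} [NormedAddCommGroup X]

theorem properLsc_mul_norm_sub (c : ℝ) (x₀ : X) :
    ProperLsc fun y => ((c * ‖y - x₀‖ : ℝ) : EReal) :=
  ⟨(continuous_coe_real_ereal.comp (by fun_prop)).lowerSemicontinuous,
    ⟨x₀, EReal.coe_ne_top _⟩, fun _ => EReal.coe_ne_bot _⟩

theorem erealLipschitzNear_mul_norm_sub {c : ℝ} (hc : 0 ≤ c) (x₀ x : X) :
    ERealLipschitzNear (fun y => ((c * ‖y - x₀‖ : ℝ) : EReal)) x := by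
  refine ⟨c, 1, one_pos, fun _ _ => ⟨EReal.coe_ne_top _, EReal.coe_ne_bot _⟩,
    fun y _ z _ => ?_⟩
  dsimp only
  norm_cast
  have := norm_sub_le_norm_sub_add_norm_sub y z x₀
  nlinarith

variable [NormedSpace ℝ X]

theorem erealConvexOn_mul_norm_sub {c : ℝ} (hc : 0 ≤ c) (x₀ : X) :
    ERealConvexOn fun y => ((c * ‖y - x₀‖ : ℝ) : EReal) := by
  intro x y a b ha hb hab
  dsimp only
  norm_cast
  have h : a • x + b • y - x₀ = a • (x - x₀) + b • (y - x₀) := by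
    nth_rewrite 1 [← one_smul ℝ x₀]
    rw [← hab]
    module
  have := norm_add_le (a • (x - x₀)) (b • (y - x₀))
  rw [norm_smul_of_nonneg ha, norm_smul_of_nonneg hb, ← h] at this
  nlinarith

theorem le_mul_norm_of_mem_clarkeSubdiff_mul_norm_sub {c : ℝ} (hc : 0 ≤ c) {x₀ x : X}
    {p : X →L[ℝ] ℝ} (hp : p ∈ clarkeSubdiff (fun y => ((c * ‖y - x₀‖ : ℝ) : EReal)) x) (w : X) :
    p w ≤ c * ‖w‖ := by
  refine EReal.coe_le_coe_iff.1 ((hp w).trans ?_)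
  refine iSup₂_le fun δ hδ => limsup_le_of_le (h := ?_)
  have hpos : ∀ᶠ q : X × ℝ in (𝓝 x ⊓ comap (fun y => ((c * ‖y - x₀‖ : ℝ) : EReal))
      (𝓝 ((c * ‖x - x₀‖ : ℝ) : EReal))) ×ˢ 𝓝[>] (0 : ℝ), 0 < q.2 :=
    tendsto_snd.eventually self_mem_nhdsWithin
  filter_upwards [hpos] with q hq
  refine (iInf₂_le w (Metric.mem_ball_self hδ)).trans ?_
  norm_cast
  rw [← div_eq_mul_inv, div_le_iff₀ hq]
  have := norm_sub_le_norm_sub_add_norm_sub (q.1 + q.2 • w) q.1 x₀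
  rw [add_sub_cancel_left, norm_smul_of_nonneg hq.le] at this
  nlinarith

end Norm

/-- The variational principle applied to `f` near a point of its domain: a nearby point, close also
in value, locally minimizes `f` plus a cone whose height over `xbar` is small. -/
theorem ProperLsc.exists_local_min_add_mul_norm {X : Type*} [NormedAddCommGroup X]
    [NormedSpace ℝ X] [CompleteSpace X] {f : X → EReal} (hf : ProperLsc f) {xbar : X} {a : ℝ}
    (ha : f xbar = a) {ε : ℝ} (hε : 0 < ε) :
    ∃ (x : X) (c : ℝ), 0 < c ∧ dist x xbar < ε ∧ ((a - ε : ℝ) : EReal) < f x ∧ f x ≤ a ∧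
      c * ‖x - xbar‖ < ε ∧ ∀ᶠ y in 𝓝 x, f x ≤ f y + ((c * ‖y - x‖ : ℝ) : EReal) := by
  obtain ⟨hlsc, -, hbot⟩ := hf
  have hlow : ∀ᶠ y in 𝓝 xbar, ((a - ε / 2 : ℝ) : EReal) < f y :=
    hlsc xbar _ (show _ < f xbar by rw [ha, EReal.coe_lt_coe_iff]; linarith)
  obtain ⟨r₀, hr₀, hball⟩ := Metric.eventually_nhds_iff.1 hlow
  obtain ⟨r, hr, hrlt⟩ := exists_between (lt_min hr₀ hε)
  have hrr₀ : r < r₀ := hrlt.trans_le (min_le_left _ _)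
  have hrε : r < ε := hrlt.trans_le (min_le_right _ _)
  let C : Set X := Metric.closedBall xbar r ∩ f ⁻¹' Iic (a : EReal)
  have hC : IsClosed C := Metric.isClosed_closedBall.inter (hlsc.isClosed_preimage _)
  have : CompleteSpace C := hC.completeSpace_coe
  let g : C → ℝ := fun y => (f y).toReal
  have hgf : ∀ y : C, ((g y : ℝ) : EReal) = f y := fun y =>
    EReal.coe_toReal (ne_top_of_le_ne_top (EReal.coe_ne_top a) y.2.2) (hbot y)
  have hg : LowerSemicontinuous g := by
    rw [lowerSemicontinuous_iff_isClosed_preimage]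
    intro b
    have : g ⁻¹' Iic b = (Subtype.val : C → X) ⁻¹' (f ⁻¹' Iic (b : EReal)) := by
      ext y
      rw [mem_preimage, mem_preimage, mem_preimage, mem_Iic, mem_Iic, ← hgf y,
        EReal.coe_le_coe_iff]
    rw [this]
    exact (hlsc.isClosed_preimage _).preimage continuous_subtype_val
  have hglow : ∀ y : C, a - ε / 2 < g y := by
    intro y
    have := hball ((Metric.mem_closedBall.1 y.2.1).trans_lt hrr₀)
    rwa [← hgf y, EReal.coe_lt_coe_iff] at this
  let x₀ : C := ⟨xbar, Metric.mem_closedBall_self hr.le, ha.le⟩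
  have hgx₀ : g x₀ = a := by
    rw [← EReal.coe_eq_coe_iff, hgf]
    exact ha
  have hc : 0 < ε / 2 / r := by positivity
  obtain ⟨x, hx, hmin⟩ := hg.exists_ekeland
    ⟨a - ε / 2, by rintro _ ⟨y, rfl⟩; exact (hglow y).le⟩ x₀ hc
  have hxlow := hglow x
  have hcdist : ε / 2 / r * dist (x : X) xbar < ε / 2 := by
    change g x + ε / 2 / r * dist (x : X) xbar ≤ _ at hx
    linarith
  have hdist : dist (x : X) xbar < r := by
    refine lt_of_mul_lt_mul_left (a := ε / 2 / r) ?_ hc.le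
    rwa [div_mul_cancel₀ _ hr.ne']
  refine ⟨x, ε / 2 / r, hc, hdist.trans hrε, ?_, x.2.2, ?_, ?_⟩
  · rw [← hgf, EReal.coe_lt_coe_iff]
    linarith
  · rw [← dist_eq_norm]
    linarith
  · filter_upwards [Metric.isOpen_ball.mem_nhds (Metric.mem_ball.2 hdist)] with y hy
    rcases le_or_gt (f y) a with hya | hya
    · have hyC : y ∈ C := ⟨Metric.ball_subset_closedBall hy, hya⟩
      have := hmin ⟨y, hyC⟩
      rw [← hgf x, ← hgf ⟨y, hyC⟩, ← dist_eq_norm]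
      exact_mod_cast this
    · refine (show f x ≤ a from x.2.2).trans (hya.le.trans (le_add_of_nonneg_right ?_))
      exact_mod_cast mul_nonneg hc.le (norm_nonneg _)

theorem Subdifferential.exists_mem_sub_near {X : Type*} [NormedAddCommGroup X] [NormedSpace ℝ X]
    [CompleteSpace X] (D : Subdifferential X) {f : X → EReal} (hf : ProperLsc f) {xbar : X} {a : ℝ}
    (ha : f xbar = a) {ε : ℝ} (hε : 0 < ε) :
    ∃ (x : X) (p : X →L[ℝ] ℝ), p ∈ D.sub f x ∧ dist x xbar < ε ∧
      ((a - ε : ℝ) : EReal) < f x ∧ f x < ((a + ε : ℝ) : EReal) ∧ p (x - xbar) < ε := by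
  obtain ⟨x, c, hc, hdist, hlow, hup, hcε, hmin⟩ := hf.exists_local_min_add_mul_norm ha hε
  have hφ := properLsc_mul_norm_sub c x
  obtain ⟨p₁, ⟨l, hl, hsub, hlx, hlf, hlw, hlsup⟩, p₂, hp₂, hadd⟩ :=
    D.separation f _ x hf hφ (erealConvexOn_mul_norm_sub hc.le x)
      (erealLipschitzNear_mul_norm_sub hc.le x x)
      (ne_top_of_le_ne_top (EReal.coe_ne_top a) hup) (by simpa using hmin)
  have hp₁ : p₁ (x - xbar) < ε := by
    have h := le_mul_norm_of_mem_clarkeSubdiff_mul_norm_sub hc.le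
      (D.subset_clarke _ hφ x hp₂) (-(x - xbar))
    have h0 : p₁ (x - xbar) + p₂ (x - xbar) = 0 := by
      simpa using DFunLike.congr_fun hadd (x - xbar)
    rw [norm_neg, map_neg] at h
    linarith
  obtain ⟨η, hη, hηε⟩ := exists_between hp₁
  have hup' : f x < ((a + ε : ℝ) : EReal) :=
    hup.trans_lt (EReal.coe_lt_coe_iff.2 (by linarith))
  have hlt := eventually_lt_of_limsup_lt
    (hlsup.trans_lt (EReal.coe_pos.2 (sub_pos.2 hηε)))
  obtain ⟨q, hq, hqx, hqlow, hqup, hqw, hqlt⟩ := (hsub.and <|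
    (hlx.eventually (Metric.isOpen_ball.mem_nhds hdist)).and <|
    (hlf.eventually_const_lt hlow).and <| (hlf.eventually_lt_const hup').and <|
    ((hlw (x - xbar)).eventually_lt_const hη).and hlt).exists
  refine ⟨q.1, q.2, hq, hqx, hqlow, hqup, ?_⟩
  rw [EReal.coe_lt_coe_iff] at hqlt
  rw [← sub_add_sub_cancel q.1 x xbar, map_add]
  linarith

/-- **Density of subdifferentials.** -/
theorem density_of_subdifferentials
    {X : Type*} [NormedAddCommGroup X] [NormedSpace ℝ X] [CompleteSpace X]
    (D : Subdifferential X) (f : X → EReal) (hf : ProperLsc f)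
    (xbar : X) (hxbar : f xbar ≠ ⊤) :
    ∃ (x : ℕ → X) (p : ℕ → X →L[ℝ] ℝ),
      (∀ n, p n ∈ D.sub f (x n)) ∧
      Filter.Tendsto x atTop (𝓝 xbar) ∧
      Filter.Tendsto (fun n => f (x n)) atTop (𝓝 (f xbar)) ∧
      Filter.limsup (fun n => (((p n) (x n - xbar) : ℝ) : EReal)) atTop ≤ 0 := by
  obtain ⟨a, ha⟩ : ∃ a : ℝ, f xbar = a :=
    ⟨_, (EReal.coe_toReal hxbar (hf.2.2 xbar)).symm⟩
  choose x p hp hx hlow hup hpx using fun n : ℕ =>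
    D.exists_mem_sub_near hf ha (Nat.one_div_pos_of_nat (α := ℝ) (n := n))
  have hlim := tendsto_one_div_add_atTop_nhds_zero_nat (𝕜 := ℝ)
  refine ⟨x, p, hp, ?_, ?_, ?_⟩
  · exact tendsto_iff_dist_tendsto_zero.2
      (squeeze_zero (fun _ => dist_nonneg) (fun n => (hx n).le) hlim)
  · rw [ha]
    refine tendsto_of_tendsto_of_tendsto_of_le_of_le
      ((continuous_coe_real_ereal.tendsto a).comp ?_)
      ((continuous_coe_real_ereal.tendsto a).comp ?_)
      (fun n => (hlow n).le) (fun n => (hup n).le)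
    · simpa using hlim.const_sub a
    · simpa using hlim.const_add a
  · have h : Tendsto (fun n : ℕ => ((1 / ((n : ℝ) + 1) : ℝ) : EReal)) atTop (𝓝 0) :=
      (continuous_coe_real_ereal.tendsto 0).comp hlim
    rw [← h.limsup_eq]
    exact limsup_le_limsup (Eventually.of_forall fun n => EReal.coe_le_coe_iff.2 (hpx n).le)
end

section
/- Let X be a real Banach space and let f : X → (−∞,+∞] be Lipschitz near x̄ ∈ X. Then for every u, v ∈ X and every real α ≥ 0: limsup_{x→_v x̄} f^r(x; u + α(x̄ − x)) = limsup_{x→_v x̄} f^r(x; u). -/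
open Filter Topology Set

/-- The radial subderivative of a locally Lipschitz function is Lipschitz in the direction. -/
lemma radialSub_le_add_of_lipschitz
    {X : Type*} [NormedAddCommGroup X] [NormedSpace ℝ X] {f : X → EReal} {x : X} {K ε : ℝ}
    (hfin : ∀ y ∈ Metric.ball x ε, f y ≠ ⊤ ∧ f y ≠ ⊥)
    (hlip : ∀ y ∈ Metric.ball x ε, ∀ z ∈ Metric.ball x ε,
      f y ≤ f z + ((K * ‖y - z‖ : ℝ) : EReal))
    {y : X} (hy : y ∈ Metric.ball x ε) (w w' : X) :
    radialSub f y w ≤ radialSub f y w' + ((K * ‖w - w'‖ : ℝ) : EReal) := by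
  have hmem : ∀ z : X, ∀ᶠ t : ℝ in 𝓝[>] (0 : ℝ), y + t • z ∈ Metric.ball x ε := by
    intro z
    have hc : Tendsto (fun t : ℝ => y + t • z) (𝓝[>] 0) (𝓝 y) := by
      have h : ContinuousAt (fun t : ℝ => y + t • z) 0 := by fun_prop
      simpa [ContinuousAt] using h.tendsto.mono_left nhdsWithin_le_nhds
    exact hc (Metric.isOpen_ball.mem_nhds hy)
  have hslope : ∀ᶠ t : ℝ in 𝓝[>] (0 : ℝ),
      erSlope f y w t ≤ ((K * ‖w - w'‖ : ℝ) : EReal) + erSlope f y w' t := by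
    filter_upwards [hmem w, hmem w', self_mem_nhdsWithin] with t h₁ h₂ ht
    have ht : 0 < t := ht
    have hl := hlip _ h₁ _ h₂
    have hn : ‖(y + t • w) - (y + t • w')‖ = t * ‖w - w'‖ := by
      rw [add_sub_add_left_eq_sub, ← smul_sub, norm_smul, Real.norm_of_nonneg ht.le]
    rw [hn] at hl
    unfold erSlope
    obtain ⟨a, ha⟩ : ∃ a : ℝ, (a : EReal) = f (y + t • w) :=
      ⟨_, EReal.coe_toReal (hfin _ h₁).1 (hfin _ h₁).2⟩
    obtain ⟨b, hb⟩ : ∃ b : ℝ, (b : EReal) = f (y + t • w') :=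
      ⟨_, EReal.coe_toReal (hfin _ h₂).1 (hfin _ h₂).2⟩
    obtain ⟨c, hc⟩ : ∃ c : ℝ, (c : EReal) = f y :=
      ⟨_, EReal.coe_toReal (hfin _ hy).1 (hfin _ hy).2⟩
    rw [← ha, ← hb] at hl
    rw [← ha, ← hb, ← hc]
    norm_cast at hl ⊢
    calc (a - c) * t⁻¹ ≤ (b + K * (t * ‖w - w'‖) - c) * t⁻¹ := by gcongr
      _ = K * ‖w - w'‖ + (b - c) * t⁻¹ := by field_simp; ring
  unfold radialSub
  calc liminf (erSlope f y w) (𝓝[>] 0)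
      ≤ liminf ((fun _ => ((K * ‖w - w'‖ : ℝ) : EReal)) + erSlope f y w') (𝓝[>] 0) :=
        liminf_le_liminf hslope
    _ ≤ limsup (fun _ => ((K * ‖w - w'‖ : ℝ) : EReal)) (𝓝[>] (0 : ℝ))
          + liminf (erSlope f y w') (𝓝[>] 0) := by
        apply EReal.liminf_add_le <;> left <;> rw [limsup_const]
        · exact EReal.coe_ne_bot _
        · exact EReal.coe_ne_top _
    _ = _ := by rw [limsup_const, add_comm]

/-- Directional limsups are monotone with respect to inequalities that hold up to an arbitrarily
small error near the base point. -/
lemma dirLimsup_le_of_forall_pos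
    {X : Type*} [NormedAddCommGroup X] [NormedSpace ℝ X] {h k : X → EReal} {x v : X}
    (H : ∀ c : ℝ, 0 < c → ∃ δ > 0, ∀ t ∈ Ioo (0 : ℝ) δ, ∀ v' ∈ Metric.ball v δ,
      h (x + t • v') ≤ k (x + t • v') + (c : EReal)) :
    dirLimsup h x v ≤ dirLimsup k x v := by
  refine le_of_forall_gt fun a ha => ?_
  obtain ⟨r, hr, hra⟩ := EReal.lt_iff_exists_real_btwn.1 ha
  obtain ⟨b, hb, hbr⟩ := EReal.lt_iff_exists_real_btwn.1 hr
  refine lt_of_le_of_lt ?_ hra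
  rw [EReal.coe_lt_coe_iff] at hbr
  obtain ⟨δ₀, hδ₀, hδH⟩ := H (r - b) (sub_pos.2 hbr)
  obtain ⟨δ₁, hδ₁, hk⟩ : ∃ δ ∈ Ioi (0 : ℝ),
      ⨆ t ∈ Ioo (0 : ℝ) δ, ⨆ v' ∈ Metric.ball v δ, k (x + t • v') < b := by
    simpa only [dirLimsup, iInf_lt_iff, exists_prop] using hb
  refine iInf₂_le_of_le (min δ₀ δ₁) (lt_min hδ₀ hδ₁) ?_
  refine iSup₂_le fun t ht => iSup₂_le fun v' hv' => ?_
  have hkb : k (x + t • v') ≤ b :=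
    (le_iSup₂_of_le t ⟨ht.1, ht.2.trans_le (min_le_right _ _)⟩
      (le_iSup₂ (f := fun w (_ : w ∈ Metric.ball v δ₁) => k (x + t • w)) v'
        (Metric.ball_subset_ball (min_le_right _ _) hv'))).trans hk.le
  calc h (x + t • v') ≤ k (x + t • v') + ((r - b : ℝ) : EReal) :=
        hδH t ⟨ht.1, ht.2.trans_le (min_le_left _ _)⟩ v'
          (Metric.ball_subset_ball (min_le_left _ _) hv')
    _ ≤ b + ((r - b : ℝ) : EReal) := by gcongr
    _ = r := by norm_cast; ring

/-- The directional neighbourhoods in the definition of `dirLimsup` are contained in arbitrarily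
small balls around the base point. -/
lemma exists_pos_norm_smul_lt
    {X : Type*} [NormedAddCommGroup X] [NormedSpace ℝ X] (v : X) {η : ℝ} (hη : 0 < η) :
    ∃ δ > 0, ∀ t ∈ Ioo (0 : ℝ) δ, ∀ v' ∈ Metric.ball v δ, ‖t • v'‖ < η := by
  have hc : Tendsto (fun p : ℝ × X => ‖p.1 • p.2‖) (𝓝 (0, v)) (𝓝 0) := by
    have h : ContinuousAt (fun p : ℝ × X => ‖p.1 • p.2‖) (0, v) := by fun_prop
    simpa [ContinuousAt] using h
  obtain ⟨δ, hδ, hb⟩ := Metric.eventually_nhds_iff_ball.1 (hc.eventually_lt_const hη)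
  refine ⟨δ, hδ, fun t ht v' hv' => hb (t, v') ?_⟩
  rw [← ball_prod_same]
  exact ⟨by simpa [abs_of_pos ht.1] using ht.2, hv'⟩

/-- For `f` Lipschitz near `xbar`, the directional limsup of the radial subderivatives
does not depend on `α ≥ 0`. -/
theorem lipschitz_dirLimsup_indep_alpha
    {X : Type*} [NormedAddCommGroup X] [NormedSpace ℝ X] [CompleteSpace X]
    (f : X → EReal) (xbar : X) (hf : ERealLipschitzNear f xbar)
    (u v : X) (α : ℝ) (hα : 0 ≤ α) :
    dirLimsup (fun x => radialSub f x (u + α • (xbar - x))) xbar v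
      = dirLimsup (fun x => radialSub f x u) xbar v := by
  obtain ⟨K, ε, hε, hfin, hlip⟩ := hf
  have key : ∀ c : ℝ, 0 < c → ∃ δ > 0, ∀ t ∈ Ioo (0 : ℝ) δ, ∀ v' ∈ Metric.ball v δ,
      xbar + t • v' ∈ Metric.ball xbar ε ∧
        K * ‖α • (xbar - (xbar + t • v'))‖ ≤ c := by
    intro c hc
    have hM : 0 < |K| * α + 1 := by positivity
    obtain ⟨δ, hδ, hsmall⟩ := exists_pos_norm_smul_lt v (lt_min hε (div_pos hc hM))
    refine ⟨δ, hδ, fun t ht v' hv' => ?_⟩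
    obtain ⟨h₁, h₂⟩ := lt_min_iff.1 (hsmall t ht v' hv')
    refine ⟨by simpa using h₁, ?_⟩
    rw [lt_div_iff₀ hM] at h₂
    rw [sub_add_cancel_left, norm_smul, norm_neg, Real.norm_of_nonneg hα]
    calc K * (α * ‖t • v'‖) ≤ |K| * (α * ‖t • v'‖) := by gcongr; exact le_abs_self K
      _ ≤ ‖t • v'‖ * (|K| * α + 1) := by linarith [norm_nonneg (t • v')]
      _ ≤ c := h₂.le
  apply le_antisymm <;> refine dirLimsup_le_of_forall_pos fun c hc => ?_ <;>
    obtain ⟨δ, hδ, hkey⟩ := key c hc <;>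
    refine ⟨δ, hδ, fun t ht v' hv' => ?_⟩ <;>
    obtain ⟨hmem, hle⟩ := hkey t ht v' hv'
  · refine (radialSub_le_add_of_lipschitz hfin hlip hmem _ u).trans ?_
    rw [add_sub_cancel_left]
    gcongr
  · refine (radialSub_le_add_of_lipschitz hfin hlip hmem _
      (u + α • (xbar - (xbar + t • v')))).trans ?_
    rw [norm_sub_rev u, add_sub_cancel_left]
    gcongr
end

section
/- Let f : ℝ → ℝ be given by f(x) = −|x| and let u ≠ 0. Then limsup_{x→_u 0} f^r(x; u) = −|u| = f^r(0;u) while limsup_{x→0} f^r(x; u) = |u|; consequently f is upper semismooth at 0 in the direction u but not strictly upper semismooth at 0 in the direction u. -/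
open Filter Topology Set

/-- If `|x + t w| = |x| + t c` for small `t > 0`, the radial subderivative of `-|·|` at `x` in the
direction `w` is `-c`. -/
lemma radialSub_negAbs_of_eventually {x w c : ℝ}
    (h : ∀ᶠ t in 𝓝[>] (0 : ℝ), |x + t * w| = |x| + t * c) :
    radialSub (fun y : ℝ => ((-|y| : ℝ) : EReal)) x w = ((-c : ℝ) : EReal) := by
  have hslope : erSlope (fun y : ℝ => ((-|y| : ℝ) : EReal)) x w
      =ᶠ[𝓝[>] (0 : ℝ)] fun _ => ((-c : ℝ) : EReal) := by
    filter_upwards [h, self_mem_nhdsWithin] with t ht ht0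
    have ht0' : t ≠ 0 := ne_of_gt ht0
    simp only [erSlope, smul_eq_mul]
    rw [ht, ← EReal.coe_sub, ← EReal.coe_mul, EReal.coe_eq_coe_iff]
    field_simp
    ring
  rw [radialSub, liminf_congr hslope, liminf_const]

lemma radialSub_negAbs_zero (w : ℝ) :
    radialSub (fun y : ℝ => ((-|y| : ℝ) : EReal)) 0 w = ((-|w| : ℝ) : EReal) := by
  apply radialSub_negAbs_of_eventually
  filter_upwards [self_mem_nhdsWithin] with t ht
  rw [zero_add, abs_zero, zero_add, abs_mul, abs_of_pos ht]

lemma tendsto_add_mul_nhdsGT_zero (x w : ℝ) :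
    Tendsto (fun t : ℝ => x + t * w) (𝓝[>] 0) (𝓝 x) := by
  have h : Continuous fun t : ℝ => x + t * w := by fun_prop
  simpa using (h.tendsto 0).mono_left nhdsWithin_le_nhds

lemma radialSub_negAbs_of_pos {x w : ℝ} (hx : 0 < x) :
    radialSub (fun y : ℝ => ((-|y| : ℝ) : EReal)) x w = ((-w : ℝ) : EReal) := by
  apply radialSub_negAbs_of_eventually
  filter_upwards [(tendsto_add_mul_nhdsGT_zero x w).eventually_const_lt hx] with t ht
  rw [abs_of_pos ht, abs_of_pos hx]

lemma radialSub_negAbs_of_neg {x w : ℝ} (hx : x < 0) :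
    radialSub (fun y : ℝ => ((-|y| : ℝ) : EReal)) x w = (w : EReal) := by
  rw [← neg_neg w]
  apply radialSub_negAbs_of_eventually
  filter_upwards [(tendsto_add_mul_nhdsGT_zero x (- -w)).eventually_lt_const hx] with t ht
  rw [abs_of_neg ht, abs_of_neg hx]
  ring

lemma radialSub_negAbs_of_mul_pos {x w : ℝ} (h : 0 < x * w) :
    radialSub (fun y : ℝ => ((-|y| : ℝ) : EReal)) x w = ((-|w| : ℝ) : EReal) := by
  rcases mul_pos_iff.mp h with ⟨hx, hw⟩ | ⟨hx, hw⟩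
  · rw [radialSub_negAbs_of_pos hx, abs_of_pos hw]
  · rw [radialSub_negAbs_of_neg hx, abs_of_neg hw, neg_neg]

/-- The function `f(x) = −|x|` is upper semismooth at `0` in any direction `u ≠ 0`,
but not strictly upper semismooth there. -/
theorem negAbs_upper_semismooth_not_strict (u : ℝ) (hu : u ≠ 0) :
    dirLimsup (fun x => radialSub (fun y : ℝ => ((-|y| : ℝ) : EReal)) x u) 0 u
        = ((-|u| : ℝ) : EReal) ∧
    radialSub (fun y : ℝ => ((-|y| : ℝ) : EReal)) 0 u = ((-|u| : ℝ) : EReal) ∧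
    ptLimsup (fun x => radialSub (fun y : ℝ => ((-|y| : ℝ) : EReal)) x u) 0
        = ((|u| : ℝ) : EReal) ∧
    UpperSemismooth (fun y : ℝ => ((-|y| : ℝ) : EReal)) 0 u ∧
    ¬ StrictUpperSemismooth (fun y : ℝ => ((-|y| : ℝ) : EReal)) 0 u := by
  have hu' : 0 < |u| := abs_pos.mpr hu
  have hdir : dirLimsup (fun x => radialSub (fun y : ℝ => ((-|y| : ℝ) : EReal)) x u) 0 u
      = ((-|u| : ℝ) : EReal) := by
    unfold dirLimsup
    apply le_antisymm
    · refine iInf₂_le_of_le |u| hu' (iSup₂_le fun t ht => iSup₂_le fun v hv => ?_)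
      rw [Metric.mem_ball, Real.dist_eq] at hv
      have huv : 0 < u * v := by
        rcases lt_or_gt_of_ne hu with h | h
        · rw [abs_of_neg h] at hv
          exact mul_pos_of_neg_of_neg h (by linarith [(abs_lt.mp hv).2])
        · rw [abs_of_pos h] at hv
          exact mul_pos h (by linarith [(abs_lt.mp hv).1])
      have hx : 0 < (0 + t • v) * u := by
        have := mul_pos ht.1 huv
        rw [zero_add, smul_eq_mul]
        linarith
      exact (radialSub_negAbs_of_mul_pos hx).le
    · refine le_iInf₂ fun δ hδ => ?_
      have hδ' : 0 < δ := hδ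
      refine le_iSup₂_of_le (δ / 2) ⟨by linarith, by linarith⟩
        (le_iSup₂_of_le u (Metric.mem_ball_self hδ') ?_)
      have hx : 0 < (0 + (δ / 2) • u) * u := by
        have := mul_pos (half_pos hδ') (mul_self_pos.mpr hu)
        rw [zero_add, smul_eq_mul]
        linarith
      exact (radialSub_negAbs_of_mul_pos hx).ge
  have hpt_ge : ∀ α ∈ Ici (0 : ℝ), ((|u| : ℝ) : EReal) ≤
      ptLimsup (fun y => radialSub (fun y : ℝ => ((-|y| : ℝ) : EReal)) y (u + α • (0 - y))) 0 := by
    intro α hα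
    have hα' : 0 ≤ α := hα
    refine le_iInf₂ fun δ hδ => ?_
    have hδ' : 0 < δ := hδ
    rcases lt_or_gt_of_ne hu with h | h
    · refine le_iSup₂_of_le (δ / 2) ?_ ?_
      · simp only [mem_ofPred_eq, sub_zero, Real.norm_eq_abs, abs_of_pos (half_pos hδ')]
        constructor <;> linarith
      · beta_reduce
        rw [radialSub_negAbs_of_pos (half_pos hδ'), EReal.coe_le_coe_iff, abs_of_neg h,
          smul_eq_mul]
        nlinarith
    · refine le_iSup₂_of_le (-(δ / 2)) ?_ ?_
      · simp only [mem_ofPred_eq, sub_zero, Real.norm_eq_abs, abs_neg, abs_of_pos (half_pos hδ')]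
        constructor <;> linarith
      · beta_reduce
        rw [radialSub_negAbs_of_neg (by linarith), EReal.coe_le_coe_iff, abs_of_pos h,
          smul_eq_mul]
        nlinarith
  refine ⟨hdir, radialSub_negAbs_zero u, le_antisymm ?_ ?_, ?_, fun hs => ?_⟩
  · refine iInf₂_le_of_le 1 (mem_Ioi.mpr one_pos) (iSup₂_le fun y hy => ?_)
    beta_reduce
    have hy0 : y ≠ 0 := by simpa using hy.1
    rcases lt_or_gt_of_ne hy0 with h | h
    · rw [radialSub_negAbs_of_neg h, EReal.coe_le_coe_iff]
      exact le_abs_self u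
    · rw [radialSub_negAbs_of_pos h, EReal.coe_le_coe_iff]
      exact neg_le_abs u
  · simpa using hpt_ge 0 self_mem_Ici
  · refine iInf₂_le_of_le 0 self_mem_Ici ?_
    simp only [zero_smul, add_zero]
    rw [hdir, radialSub_negAbs_zero]
  · have h := (le_iInf₂ hpt_ge).trans hs
    rw [radialSub_negAbs_zero, EReal.coe_le_coe_iff] at h
    linarith
end

section
/- (Radial stability of the upper radial subderivative) Let X be a real Banach space, let f : X → (−∞,+∞] be proper lower semicontinuous, let x̄ ∈ dom f and u ∈ X be such that f is radially accessible at x̄ from u. Then there is a sequence μₙ ↘ 0 such that f(x̄ + μₙu) → f(x̄) and f^r_+(x̄;u) ≤ liminfₙ f^r(x̄ + μₙu; u). In particular, f^r_+(x̄;u) ≤ inf_{α≥0} limsup_{x→_u x̄} f^r(x; u + α(x̄ − x)). -/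
open Filter Topology Set

/-- Slope bounds from below are affine minorant bounds, at points where `f` is finite. -/
theorem coe_le_erSlope_iff {X : Type*} [NormedAddCommGroup X] [NormedSpace ℝ X]
    {f : X → EReal} {x u : X} {a t : ℝ} (hx : f x = a) (ht : 0 < t) (m : ℝ) :
    (m : EReal) ≤ erSlope f x u t ↔ ((a + m * t : ℝ) : EReal) ≤ f (x + t • u) := by
  have ht' : 0 < t⁻¹ := inv_pos.2 ht
  rw [erSlope, hx]
  induction f (x + t • u) with
  | bot => simp [EReal.bot_mul_coe_of_pos ht', -EReal.coe_add, -EReal.coe_mul]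
  | top => simp [EReal.top_mul_coe_of_pos ht']
  | coe b =>
    norm_cast
    rw [← div_eq_mul_inv, le_div_iff₀ ht, le_sub_iff_add_le']

/-- A positive rescaling of the direction rescales lower bounds of the radial subderivative. -/
theorem coe_mul_le_radialSub_smul {X : Type*} [NormedAddCommGroup X] [NormedSpace ℝ X]
    {f : X → EReal} {x u : X} {a m c : ℝ} (hx : f x = a) (hc : 0 < c)
    (h : ∀ᶠ t in 𝓝[>] (0 : ℝ), ((a + m * t : ℝ) : EReal) ≤ f (x + t • u)) :
    ((c * m : ℝ) : EReal) ≤ radialSub f x (c • u) := by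
  have hlim : Tendsto (fun t : ℝ => t * c) (𝓝[>] 0) (𝓝[>] 0) := by
    refine tendsto_nhdsWithin_iff.2 ⟨?_, ?_⟩
    · exact ((continuous_mul_const c).tendsto' 0 0 (zero_mul c)).mono_left nhdsWithin_le_nhds
    · filter_upwards [self_mem_nhdsWithin] with t ht using mul_pos ht hc
  refine le_liminf_of_le (by isBoundedDefault) ?_
  filter_upwards [hlim.eventually h, self_mem_nhdsWithin] with t ht ht0
  rw [coe_le_erSlope_iff hx ht0, smul_smul]
  convert ht using 2
  ring

/-- A lower semicontinuous function on the line which is accessible at `0` from the right and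
whose graph meets the region above a line of slope `m` arbitrarily close to `0` supports, at
points arbitrarily close to `0` and with almost no larger values, local affine minorants
of slope `m` on the right. -/
theorem exists_right_affine_minorant {g : ℝ → EReal} (hg : LowerSemicontinuous g)
    (hbot : ∀ t, g t ≠ ⊥) {a₀ m ε : ℝ} (hε : 0 < ε)
    (hacc : ∀ b : ℝ, a₀ < b → ∃ᶠ t in 𝓝[>] (0 : ℝ), g t < b)
    (hslope : ∃ᶠ t in 𝓝[>] (0 : ℝ), ((a₀ + m * t : ℝ) : EReal) < g t) :
    ∃ r, 0 < r ∧ r < ε ∧ ∃ a : ℝ, g r = a ∧ a < a₀ + ε ∧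
      ∀ᶠ t in 𝓝[>] (0 : ℝ), ((a + m * t : ℝ) : EReal) ≤ g (r + t) := by
  have hsmall (η : ℝ) (hη : 0 < η) : ∀ᶠ t in 𝓝[>] (0 : ℝ), |m * t| < η := by
    have : Tendsto (fun t : ℝ => |m * t|) (𝓝 0) (𝓝 0) :=
      Continuous.tendsto' (by fun_prop) 0 0 (by simp)
    exact (this.mono_left nhdsWithin_le_nhds).eventually_lt_const hη
  obtain ⟨t, htg, htm, ht0, htε⟩ := (hslope.and_eventually
    ((hsmall (ε / 2) (by positivity)).and (Ioo_mem_nhdsGT hε))).exists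
  obtain ⟨b, hab, hbg⟩ := EReal.lt_iff_exists_real_btwn.1 htg
  rw [EReal.coe_lt_coe_iff] at hab
  obtain ⟨η, hη0, hηε, hηb⟩ : ∃ η : ℝ, 0 < η ∧ η ≤ ε / 2 ∧ a₀ + η + m * t ≤ b :=
    ⟨min (ε / 2) (b - (a₀ + m * t)), lt_min (by positivity) (by linarith), min_le_left _ _,
      by linarith [min_le_right (ε / 2) (b - (a₀ + m * t))]⟩
  obtain ⟨s, hsg, hsm, hs0, hst⟩ := ((hacc (a₀ + η / 2) (by linarith)).and_eventually
    ((hsmall (η / 2) (by positivity)).and (Ioo_mem_nhdsGT ht0))).exists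
  have hclosed : IsClosed {r : ℝ | g r ≤ ((a₀ + η + m * r : ℝ) : EReal)} :=
    hg.isClosed_epigraph.preimage
      (continuous_id.prodMk (continuous_coe_real_ereal.comp (by fun_prop)))
  have hsK : s ∈ Icc 0 t ∩ {r : ℝ | g r ≤ ((a₀ + η + m * r : ℝ) : EReal)} := by
    refine ⟨⟨hs0.le, hst.le⟩, hsg.le.trans (EReal.coe_le_coe_iff.2 ?_)⟩
    linarith [(abs_lt.1 hsm).1]
  obtain ⟨r, ⟨⟨hr0, hrt⟩, hrg⟩, hrmax⟩ :=
    (isCompact_Icc.inter_right hclosed).exists_isGreatest ⟨s, hsK⟩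
  have hr0' : 0 < r := hs0.trans_le (hrmax hsK)
  have hrt' : r < t := by
    refine hrt.lt_of_ne ?_
    rintro rfl
    exact (hbg.trans_le hrg).not_ge (EReal.coe_le_coe_iff.2 hηb)
  obtain ⟨a, ha⟩ : ∃ a : ℝ, g r = a :=
    ⟨(g r).toReal, (EReal.coe_toReal (hrg.trans_lt (EReal.coe_lt_top _)).ne (hbot r)).symm⟩
  have har : a ≤ a₀ + η + m * r := by
    rw [mem_ofPred_eq, ha] at hrg
    exact EReal.coe_le_coe_iff.1 hrg
  refine ⟨r, hr0', hrt'.trans htε, a, ha, ?_, ?_⟩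
  · have : |m * r| ≤ |m * t| := by
      rw [abs_mul, abs_mul, abs_of_pos hr0', abs_of_pos ht0]
      gcongr
    linarith [le_abs_self (m * r)]
  · filter_upwards [Ioo_mem_nhdsGT (sub_pos.2 hrt')] with q hq
    by_contra! hlt
    have hmem : r + q ∈ Icc 0 t ∩ {r : ℝ | g r ≤ ((a₀ + η + m * r : ℝ) : EReal)} := by
      refine ⟨⟨by linarith [hq.1], by linarith [hq.2]⟩,
        hlt.le.trans (EReal.coe_le_coe_iff.2 ?_)⟩
      linarith
    linarith [hrmax hmem, hq.1]

/-- Radial accessibility produces points on the ray with almost no larger values. -/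
theorem RadiallyAccessible.frequently_lt {X : Type*} [NormedAddCommGroup X] [NormedSpace ℝ X]
    {f : X → EReal} {x u : X} (h : RadiallyAccessible f x u) {b : EReal} (hb : f x < b) :
    ∃ᶠ t in 𝓝[>] (0 : ℝ), f (x + t • u) < b :=
  frequently_lt_of_liminf_lt (by isBoundedDefault) (h ▸ hb)

/-- Every real number below the upper radial subderivative is the slope of local affine minorants
along the ray, at points close to the base point in the graph of `f`. -/
theorem exists_affine_minorant_of_lt_radialSubPlus {X : Type*} [NormedAddCommGroup X]
    [NormedSpace ℝ X] {f : X → EReal} (hf : LowerSemicontinuous f) (hbot : ∀ x, f x ≠ ⊥)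
    {x u : X} (hacc : RadiallyAccessible f x u) {a₀ m ε : ℝ} (hx : f x = a₀)
    (hm : (m : EReal) < radialSubPlus f x u) (hε : 0 < ε) :
    ∃ r, 0 < r ∧ r < ε ∧ ∃ a : ℝ, f (x + r • u) = a ∧ a < a₀ + ε ∧
      ∀ᶠ t in 𝓝[>] (0 : ℝ), ((a + m * t : ℝ) : EReal) ≤ f (x + r • u + t • u) := by
  obtain ⟨m', hmm', hm'⟩ := EReal.lt_iff_exists_real_btwn.1 hm
  rw [EReal.coe_lt_coe_iff] at hmm'
  have hg : LowerSemicontinuous fun t : ℝ => f (x + t • u) := hf.comp (by fun_prop)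
  obtain ⟨r, hr0, hrε, a, ha, haε, hev⟩ := exists_right_affine_minorant (m := m) hg
    (fun _ => hbot _) hε
    (fun b hb => hacc.frequently_lt (by rw [hx]; exact EReal.coe_lt_coe_iff.2 hb))
    (((frequently_lt_of_lt_limsup (by isBoundedDefault) hm').and_eventually
      self_mem_nhdsWithin).mono fun t ⟨ht, ht0⟩ => by
        refine lt_of_lt_of_le (EReal.coe_lt_coe_iff.2 ?_) ((coe_le_erSlope_iff hx ht0 m').1 ht.le)
        linarith [mul_lt_mul_of_pos_right hmm' (mem_Ioi.1 ht0)])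
  refine ⟨r, hr0, hrε, a, ha, haε, ?_⟩
  simpa only [add_smul, add_assoc] using hev

/-- **Radial stability of the upper radial subderivative.** -/
theorem radial_stability
    {X : Type*} [NormedAddCommGroup X] [NormedSpace ℝ X] [CompleteSpace X]
    (f : X → EReal) (hf : ProperLsc f) (xbar : X) (hxbar : f xbar ≠ ⊤) (u : X)
    (hacc : RadiallyAccessible f xbar u) :
    (∃ μ : ℕ → ℝ, (∀ n, 0 < μ n) ∧ Filter.Tendsto μ atTop (𝓝 0) ∧
      Filter.Tendsto (fun n => f (xbar + μ n • u)) atTop (𝓝 (f xbar)) ∧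
      radialSubPlus f xbar u ≤ Filter.liminf (fun n => radialSub f (xbar + μ n • u) u) atTop) ∧
    radialSubPlus f xbar u
      ≤ ⨅ α ∈ Set.Ici (0:ℝ), dirLimsup (fun x => radialSub f x (u + α • (xbar - x))) xbar u := by
  obtain ⟨hlsc, -, hbot⟩ := hf
  obtain ⟨a₀, hx⟩ : ∃ a : ℝ, f xbar = a :=
    ⟨(f xbar).toReal, (EReal.coe_toReal hxbar (hbot xbar)).symm⟩
  refine ⟨?_, ?_⟩
  · obtain ⟨L, hL, hpts⟩ : ∃ L : ℕ → EReal, Tendsto L atTop (𝓝 (radialSubPlus f xbar u)) ∧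
        ∀ n (ε : ℝ), 0 < ε → ∃ r, 0 < r ∧ r < ε ∧
          f (xbar + r • u) < ((a₀ + ε : ℝ) : EReal) ∧ L n ≤ radialSub f (xbar + r • u) u := by
      rcases eq_bot_or_bot_lt (radialSubPlus f xbar u) with hD | hD
      · refine ⟨fun _ => ⊥, hD ▸ tendsto_const_nhds, fun n ε hε => ?_⟩
        have hlt : f xbar < ((a₀ + ε : ℝ) : EReal) := by
          rw [hx]
          exact EReal.coe_lt_coe_iff.2 (by linarith)
        obtain ⟨r, hr, hr0, hrε⟩ :=
          ((hacc.frequently_lt hlt).and_eventually (Ioo_mem_nhdsGT hε)).exists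
        exact ⟨r, hr0, hrε, hr, bot_le⟩
      · obtain ⟨L, -, hLmem, hL⟩ := exists_seq_strictMono_tendsto' hD
        refine ⟨L, hL, fun n ε hε => ?_⟩
        have hLn : ((L n).toReal : EReal) = L n :=
          EReal.coe_toReal ((hLmem n).2.trans_le le_top).ne (hLmem n).1.ne'
        obtain ⟨r, hr0, hrε, a, ha, haε, hev⟩ := exists_affine_minorant_of_lt_radialSubPlus hlsc
          hbot hacc hx (hLn.symm ▸ (hLmem n).2) hε
        refine ⟨r, hr0, hrε, ?_, ?_⟩
        · rw [ha]
          exact EReal.coe_lt_coe_iff.2 haε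
        · simpa [hLn] using coe_mul_le_radialSub_smul ha one_pos hev
    choose μ hμ0 hμε hμf hμL using fun n : ℕ => hpts n (1 / ((n : ℝ) + 1)) (by positivity)
    have hμ : Tendsto μ atTop (𝓝 0) :=
      squeeze_zero (fun n => (hμ0 n).le) (fun n => (hμε n).le) tendsto_one_div_add_atTop_nhds_zero_nat
    have hpt : Tendsto (fun n => xbar + μ n • u) atTop (𝓝 xbar) := by
      simpa using (hμ.smul_const u).const_add xbar
    have hub : Tendsto (fun n : ℕ => ((a₀ + 1 / ((n : ℝ) + 1) : ℝ) : EReal)) atTop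
        (𝓝 (f xbar)) := by
      rw [hx]
      refine (continuous_coe_real_ereal.tendsto a₀).comp ?_
      simpa using (tendsto_one_div_add_atTop_nhds_zero_nat (𝕜 := ℝ)).const_add a₀
    refine ⟨μ, hμ0, hμ, tendsto_order.2 ⟨fun b hb => hpt.eventually (hlsc xbar b hb),
      fun b hb => ?_⟩, ?_⟩
    · filter_upwards [hub.eventually_lt_const hb] with n hn using (hμf n).trans hn
    · rw [← hL.liminf_eq]
      exact liminf_le_liminf (Eventually.of_forall hμL)
  · refine le_iInf₂ fun α _ => le_iInf₂ fun δ hδ => ?_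
    refine EReal.ge_of_forall_gt_iff_ge.1 fun m hm => ?_
    obtain ⟨m', hmm', hm'⟩ := EReal.lt_iff_exists_real_btwn.1 hm
    rw [EReal.coe_lt_coe_iff] at hmm'
    have hscale : ∀ᶠ t in 𝓝 (0 : ℝ), 0 < 1 - α * t ∧ m < (1 - α * t) * m' := by
      refine (Continuous.tendsto' (by fun_prop) 0 1 (by simp)).eventually_const_lt one_pos |>.and ?_
      exact (Continuous.tendsto' (by fun_prop) 0 m' (by simp)).eventually_const_lt hmm'
    obtain ⟨ε, hε, hball⟩ := Metric.eventually_nhds_iff.1 hscale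
    obtain ⟨r, hr0, hrε, a, ha, -, hev⟩ := exists_affine_minorant_of_lt_radialSubPlus hlsc
      hbot hacc hx hm' (lt_min hε hδ)
    obtain ⟨hc, hmc⟩ := hball (y := r)
      (by rw [Real.dist_0_eq_abs, abs_of_pos hr0]; exact hrε.trans_le (min_le_left _ _))
    have hdir : u + α • (xbar - (xbar + r • u)) = (1 - α * r) • u := by module
    calc (m : EReal) ≤ (((1 - α * r) * m' : ℝ) : EReal) := EReal.coe_le_coe_iff.2 hmc.le
      _ ≤ radialSub f (xbar + r • u) (u + α • (xbar - (xbar + r • u))) :=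
        hdir ▸ coe_mul_le_radialSub_smul ha hc hev
      _ ≤ _ := le_iSup₂_of_le r ⟨hr0, hrε.trans_le (min_le_right _ _)⟩
        (le_iSup₂ (f := fun v (_ : v ∈ Metric.ball u δ) =>
          radialSub f (xbar + r • v) (u + α • (xbar - (xbar + r • v))))
          u (Metric.mem_ball_self hδ))
end

section
/- Let X be a real Banach space, let f : X → (−∞,+∞] be proper lower semicontinuous, let x̄ ∈ dom f and u ∈ X. If f is radially accessible at x̄ from u and f is upper semismooth at x̄ in the direction u, then f^r(x̄;u) = f^r_+(x̄;u) and f^r(x̄;u) = inf_{α≥0} limsup_{x→_u x̄} f^r(x; u + α(x̄ − x)). -/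
open Filter Topology Set

/-- A lower semicontinuous function that can always be continued to the right with slope at most
`L` lies below the line of slope `L` through its starting value. -/
theorem le_line_of_forall_exists_step {φ : ℝ → EReal} (hφ : LowerSemicontinuous φ)
    {L a b p : ℝ} (hab : a ≤ b) (ha : φ a ≤ (p : EReal))
    (hstep : ∀ s ∈ Ico a b,
      ∃ t ∈ Ioc s b, ∀ q : ℝ, φ s ≤ (q : EReal) → φ t ≤ ((q + L * (t - s) : ℝ) : EReal)) :
    φ b ≤ ((p + L * (b - a) : ℝ) : EReal) := by
  let S : Set ℝ := {t | t ∈ Icc a b ∧ φ t ≤ ((p + L * (t - a) : ℝ) : EReal)}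
  have hS : IsCompact S := by
    refine isCompact_Icc.inter_right (t := {t | φ t ≤ ((p + L * (t - a) : ℝ) : EReal)}) ?_
    have hc : Continuous fun t : ℝ => (t, ((p + L * (t - a) : ℝ) : EReal)) :=
      continuous_id.prodMk (continuous_coe_real_ereal.comp (by fun_prop))
    exact hφ.isClosed_epigraph.preimage hc
  have hne : S.Nonempty := ⟨a, left_mem_Icc.2 hab, by simpa using ha⟩
  obtain ⟨s, ⟨hs, hsp⟩, hmax⟩ := hS.exists_isGreatest hne
  rcases hs.2.eq_or_lt with rfl | hsb
  · exact hsp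
  · obtain ⟨t, ht, hq⟩ := hstep s ⟨hs.1, hsb⟩
    have htS : t ∈ S := by
      refine ⟨⟨hs.1.trans ht.1.le, ht.2⟩, ?_⟩
      have := hq _ hsp
      rwa [show p + L * (s - a) + L * (t - s) = p + L * (t - a) by ring] at this
    exact absurd (hmax htS) (not_le.2 ht.1)

/-- A strict real bound on the difference quotient gives an affine bound on the value. -/
theorem le_of_erSlope_lt {X : Type*} [NormedAddCommGroup X] [NormedSpace ℝ X]
    {f : X → EReal} {x w : X} {t l q : ℝ} (ht : 0 < t) (hbot : f x ≠ ⊥)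
    (h : erSlope f x w t < (l : EReal)) (hq : f x ≤ (q : EReal)) :
    f (x + t • w) ≤ ((q + l * t : ℝ) : EReal) := by
  unfold erSlope at h
  lift f x to ℝ using ⟨ne_top_of_le_ne_top (EReal.coe_ne_top _) hq, hbot⟩ with r
  induction hy : f (x + t • w) with
  | bot => exact bot_le
  | top =>
    rw [hy, EReal.top_sub_coe, EReal.top_mul_coe_of_pos (inv_pos.2 ht)] at h
    exact absurd h not_top_lt
  | coe y =>
    rw [hy, ← EReal.coe_sub, ← EReal.coe_mul, EReal.coe_lt_coe_iff, ← div_eq_mul_inv,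
      div_lt_iff₀ ht] at h
    rw [EReal.coe_le_coe_iff] at hq ⊢
    linarith

/-- An affine bound on the value gives a bound on the difference quotient. -/
theorem erSlope_le_of_le {X : Type*} [NormedAddCommGroup X] [NormedSpace ℝ X]
    {f : X → EReal} {x w : X} {t l q : ℝ} (ht : 0 < t) (hq : f x = (q : EReal))
    (h : f (x + t • w) ≤ ((q + l * t : ℝ) : EReal)) :
    erSlope f x w t ≤ (l : EReal) := by
  unfold erSlope
  rw [hq]
  induction hy : f (x + t • w) with
  | bot => simp [EReal.bot_mul_coe_of_pos (inv_pos.2 ht)]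
  | top =>
    rw [hy] at h
    exact absurd h (not_le.2 (EReal.coe_lt_top _))
  | coe y =>
    rw [hy, EReal.coe_le_coe_iff] at h
    rw [← EReal.coe_sub, ← EReal.coe_mul, EReal.coe_le_coe_iff, ← div_eq_mul_inv, div_le_iff₀ ht]
    linarith

theorem exists_forall_lt_of_dirLimsup_lt {X : Type*} [NormedAddCommGroup X] [NormedSpace ℝ X]
    {h : X → EReal} {x v : X} {c : EReal} (hc : dirLimsup h x v < c) :
    ∃ δ > (0 : ℝ), ∀ t ∈ Ioo (0 : ℝ) δ, h (x + t • v) < c := by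
  simp only [dirLimsup, iInf_lt_iff] at hc
  obtain ⟨δ, hδ, hlt⟩ := hc
  refine ⟨δ, hδ, fun t ht => lt_of_le_of_lt ?_ hlt⟩
  exact le_iSup₂_of_le t ht
    (le_iSup₂ (f := fun v' (_ : v' ∈ Metric.ball v δ) => h (x + t • v')) v
      (Metric.mem_ball_self hδ))

/-- For a radially accessible lower semicontinuous function, the upper radial subderivative is
bounded by the directional limsup of the nearby radial subderivatives. -/
theorem radialSubPlus_le_iInf_dirLimsup {X : Type*} [NormedAddCommGroup X] [NormedSpace ℝ X]
    {f : X → EReal} (hf : LowerSemicontinuous f) (hbot : ∀ x, f x ≠ ⊥) {x u : X}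
    (hx : f x ≠ ⊤) (hacc : RadiallyAccessible f x u) :
    radialSubPlus f x u ≤
      ⨅ α ∈ Set.Ici (0 : ℝ), dirLimsup (fun y => radialSub f y (u + α • (x - y))) x u := by
  refine le_iInf₂ fun α _ => le_of_forall_gt_imp_ge_of_dense fun c hc => ?_
  obtain ⟨l, hl, hlc⟩ := EReal.lt_iff_exists_real_btwn.1 hc
  obtain ⟨L, hlL, hLc⟩ := EReal.lt_iff_exists_real_btwn.1 hlc
  rw [EReal.coe_lt_coe_iff] at hlL
  obtain ⟨δ, hδ, hD⟩ := exists_forall_lt_of_dirLimsup_lt hl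
  obtain ⟨q, hq⟩ : ∃ q : ℝ, f x = q := ⟨(f x).toReal, (EReal.coe_toReal hx (hbot x)).symm⟩
  have hsmall : ∀ᶠ s in 𝓝 (0 : ℝ), l < L * (1 - α * s) ∧ 0 < 1 - α * s := by
    refine Eventually.and ?_ ?_
    · exact ((by fun_prop : Continuous fun s : ℝ => L * (1 - α * s)).tendsto 0).eventually_const_lt
        (by simpa using hlL)
    · exact ((by fun_prop : Continuous fun s : ℝ => 1 - α * s).tendsto 0).eventually_const_lt
        (by simp)
  obtain ⟨η, hη, hη'⟩ := Metric.eventually_nhds_iff.1 hsmall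
  have hφ : LowerSemicontinuous fun t : ℝ => f (x + t • u) := hf.comp (by fun_prop)
  have hstep : ∀ s b : ℝ, 0 < s → s < b → s < δ → s < η → ∃ t ∈ Ioc s b, ∀ q : ℝ,
      f (x + s • u) ≤ (q : EReal) → f (x + t • u) ≤ ((q + L * (t - s) : ℝ) : EReal) := by
    intro s b hs hsb hsδ hsη
    obtain ⟨hc1, hc0⟩ := hη' (y := s) (by simpa [abs_of_pos hs] using hsη)
    have hfreq := frequently_lt_of_liminf_lt (by isBoundedDefault) (hD s ⟨hs, hsδ⟩)
    have hev : ∀ᶠ τ in 𝓝[>] (0 : ℝ), τ ∈ Ioo (0 : ℝ) ((b - s) / (1 - α * s)) :=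
      Ioo_mem_nhdsGT (div_pos (sub_pos.2 hsb) hc0)
    obtain ⟨τ, hτ, hτ0, hτb⟩ := (hfreq.and_eventually hev).exists
    rw [lt_div_iff₀ hc0] at hτb
    refine ⟨s + τ * (1 - α * s), ⟨by nlinarith, by linarith⟩, fun r hr => ?_⟩
    have hle := le_of_erSlope_lt hτ0 (hbot _) hτ hr
    have hpt : x + s • u + τ • (u + α • (x - (x + s • u))) = x + (s + τ * (1 - α * s)) • u := by
      module
    rw [hpt] at hle
    refine hle.trans (EReal.coe_le_coe_iff.2 ?_)
    nlinarith [mul_le_mul_of_nonneg_left hc1.le hτ0.le]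
  have hline : ∀ t : ℝ, 0 < t → t < δ → t < η →
      f (x + t • u) ≤ ((q + L * t : ℝ) : EReal) := by
    intro t ht htδ htη
    refine EReal.le_of_forall_lt_iff_le.1 fun z hz => ?_
    rw [EReal.coe_lt_coe_iff] at hz
    have hfreq : ∃ᶠ a in 𝓝[>] (0 : ℝ),
        f (x + a • u) < ((q + (z - (q + L * t)) / 2 : ℝ) : EReal) := by
      refine frequently_lt_of_liminf_lt (by isBoundedDefault) ?_
      rw [← hacc, hq, EReal.coe_lt_coe_iff]
      linarith
    have hev : ∀ᶠ a in 𝓝[>] (0 : ℝ), a ∈ Ioo (0 : ℝ) t := Ioo_mem_nhdsGT ht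
    have hev' : ∀ᶠ a in 𝓝[>] (0 : ℝ), -(L * a) < (z - (q + L * t)) / 2 :=
      (((by fun_prop : Continuous fun a : ℝ => -(L * a)).tendsto 0).eventually_lt_const
        (by simp; linarith)).filter_mono nhdsWithin_le_nhds
    obtain ⟨a, ha, ha0, ha1⟩ := (hfreq.and_eventually (hev.and hev')).exists
    have hle := le_line_of_forall_exists_step hφ (L := L) ha0.2.le ha.le fun s hs =>
      hstep s t (ha0.1.trans_le hs.1) hs.2 (hs.2.trans htδ) (hs.2.trans htη)
    refine hle.trans (EReal.coe_le_coe_iff.2 ?_)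
    linarith
  refine le_trans ?_ hLc.le
  refine limsup_le_of_le (by isBoundedDefault) ?_
  filter_upwards [Ioo_mem_nhdsGT (lt_min hδ hη)] with t ht
  exact erSlope_le_of_le ht.1 hq
    (hline t ht.1 (ht.2.trans_le (min_le_left _ _)) (ht.2.trans_le (min_le_right _ _)))

/-- For a radially accessible upper semismooth function, the lower and upper radial
subderivatives coincide and are given by the formula. -/
theorem upper_semismooth_radially_accessible
    {X : Type*} [NormedAddCommGroup X] [NormedSpace ℝ X] [CompleteSpace X]
    (f : X → EReal) (hf : ProperLsc f) (xbar : X) (hxbar : f xbar ≠ ⊤) (u : X)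
    (hacc : RadiallyAccessible f xbar u) (huss : UpperSemismooth f xbar u) :
    radialSub f xbar u = radialSubPlus f xbar u ∧
    radialSub f xbar u
      = ⨅ α ∈ Set.Ici (0:ℝ), dirLimsup (fun x => radialSub f x (u + α • (xbar - x))) xbar u := by
  have hle := radialSubPlus_le_iInf_dirLimsup hf.1 hf.2.2 hxbar hacc
  have hr : radialSub f xbar u ≤ radialSubPlus f xbar u := liminf_le_limsup
  exact ⟨hr.antisymm (hle.trans huss), (hr.trans hle).antisymm huss⟩
end

section
/- Let X be a real Banach space, let f : X → ℝ be Lipschitz near x̄ ∈ X, and let u ∈ X. Then f is strictly upper semismooth at x̄ in the direction u if and only if f^r(x̄;u) = f^0(x̄;u), where f^0 is the Clarke subderivative. -/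
open Filter Topology Set

theorem erSlope_coe {X : Type*} [NormedAddCommGroup X] [NormedSpace ℝ X]
    (f : X → ℝ) (x u : X) (t : ℝ) :
    erSlope (fun x => ((f x : ℝ) : EReal)) x u t = (((f (x + t • u) - f x) * t⁻¹ : ℝ) : EReal) := by
  simp [erSlope, EReal.coe_mul, EReal.coe_sub]

theorem clarkeSub_eq_limsup_erSlope {X : Type*} [NormedAddCommGroup X] [NormedSpace ℝ X]
    (f : X → EReal) (x u : X) :
    clarkeSub f x u
      = limsup (fun p : X × ℝ => erSlope f p.1 u p.2) (𝓝 x ×ˢ 𝓝[>] (0 : ℝ)) := rfl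

theorem radialSub_le_clarkeSub {X : Type*} [NormedAddCommGroup X] [NormedSpace ℝ X]
    (f : X → EReal) (x u : X) : radialSub f x u ≤ clarkeSub f x u := by
  have h : Tendsto (fun t : ℝ => (x, t)) (𝓝[>] (0 : ℝ)) (𝓝 x ×ˢ 𝓝[>] (0 : ℝ)) :=
    tendsto_const_nhds.prodMk tendsto_id
  calc radialSub f x u ≤ limsup (erSlope f x u) (𝓝[>] (0 : ℝ)) := liminf_le_limsup
    _ = limsup (fun p : X × ℝ => erSlope f p.1 u p.2) (map (fun t : ℝ => (x, t)) (𝓝[>] 0)) := rfl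
    _ ≤ clarkeSub f x u := limsup_le_limsup_of_le h

theorem ptLimsup_radialSub_le_clarkeSub {X : Type*} [NormedAddCommGroup X] [NormedSpace ℝ X]
    (f : X → EReal) (x u : X) : ptLimsup (fun y => radialSub f y u) x ≤ clarkeSub f x u := by
  refine le_of_forall_gt_imp_ge_of_dense fun c hc => ?_
  rw [clarkeSub_eq_limsup_erSlope] at hc
  have h := (eventually_lt_of_limsup_lt hc).curry
  obtain ⟨δ, hδ, hball⟩ := Metric.eventually_nhds_iff.1 h
  refine iInf₂_le_of_le δ hδ (iSup₂_le fun y hy => ?_)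
  have hy' := hball (y := y) (by rw [dist_eq_norm]; exact hy.2)
  exact (liminf_le_liminf (hy'.mono fun t ht => le_of_lt ht)).trans_eq (liminf_const c)

/-- Mean value inequality for a lower right Dini derivative on an open interval. -/
theorem sub_le_mul_of_frequently_slope_lt {g : ℝ → ℝ} {a b c : ℝ} (hab : a ≤ b)
    (hg : ContinuousOn g (Icc a b))
    (h : ∀ s ∈ Ioo a b, ∃ᶠ t in 𝓝[>] (0 : ℝ), (g (s + t) - g s) * t⁻¹ < c) :
    g b - g a ≤ c * (b - a) := by
  rcases hab.eq_or_lt with rfl | hab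
  · simp
  have key : ∀ s ∈ Ioo a b, g b ≤ g s + c * (b - s) := by
    intro s hs
    refine image_le_of_liminf_slope_right_le_deriv_boundary (f := g) (a := s) (b := b)
      (B := fun z => g s + c * (z - s)) (B' := fun _ => c)
      (hg.mono (Icc_subset_Icc_left hs.1.le)) (by simp) (by fun_prop) ?_ ?_
      (right_mem_Icc.2 hs.2.le)
    · intro z _
      have := ((((hasDerivAt_id z).sub_const s).const_mul c).const_add (g s)).hasDerivWithinAt
        (s := Ici z)
      simpa using this
    · intro z hz r hr
      have ht : Tendsto (fun t : ℝ => z + t) (𝓝[>] 0) (𝓝[>] z) := by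
        refine tendsto_nhdsWithin_iff.2 ⟨?_, ?_⟩
        · have : Tendsto (fun t : ℝ => z + t) (𝓝 0) (𝓝 (z + 0)) := by
            exact (continuous_const.add continuous_id).tendsto 0
          rw [add_zero] at this
          exact this.mono_left nhdsWithin_le_nhds
        · filter_upwards [self_mem_nhdsWithin] with t ht
          simpa using ht
      refine ht.frequently ((h z ⟨hs.1.trans_le hz.1, hz.2⟩).mono fun t ht => ?_)
      rw [slope_def_field, add_sub_cancel_left, div_eq_mul_inv]
      exact ht.trans hr
  have hlim : Tendsto (fun s => g s + c * (b - s)) (𝓝[Ioo a b] a) (𝓝 (g a + c * (b - a))) := by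
    refine ((hg a (left_mem_Icc.2 hab.le)).mono Ioo_subset_Icc_self).add ?_
    exact ((by fun_prop : Continuous fun s : ℝ => c * (b - s)).tendsto a).mono_left
      nhdsWithin_le_nhds
  have : (𝓝[Ioo a b] a).NeBot := left_nhdsWithin_Ioo_neBot hab
  have := ge_of_tendsto hlim (eventually_mem_nhdsWithin.mono key)
  linarith

/-- The mean value inequality still holds if the Dini derivative bound fails at one point. -/
theorem sub_le_mul_of_frequently_slope_lt_of_ne {g : ℝ → ℝ} {a b c p : ℝ} (hab : a ≤ b)
    (hg : ContinuousOn g (Icc a b))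
    (h : ∀ s ∈ Ioo a b, s ≠ p → ∃ᶠ t in 𝓝[>] (0 : ℝ), (g (s + t) - g s) * t⁻¹ < c) :
    g b - g a ≤ c * (b - a) := by
  by_cases hp : p ∈ Ioo a b
  · have h₁ := sub_le_mul_of_frequently_slope_lt hp.1.le
      (hg.mono (Icc_subset_Icc_right hp.2.le))
      fun s hs => h s ⟨hs.1, hs.2.trans hp.2⟩ hs.2.ne
    have h₂ := sub_le_mul_of_frequently_slope_lt hp.2.le
      (hg.mono (Icc_subset_Icc_left hp.1.le))
      fun s hs => h s ⟨hp.1.trans hs.1, hs.2⟩ hs.1.ne'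
    linarith
  · exact sub_le_mul_of_frequently_slope_lt hab hg fun s hs => h s hs fun hsp => hp (hsp ▸ hs)

theorem frequently_slope_lt_of_radialSub_lt {X : Type*} [NormedAddCommGroup X] [NormedSpace ℝ X]
    {f : X → ℝ} {S : Set X} {K : NNReal} (hS : IsOpen S) (hf : LipschitzOnWith K f S)
    {y u v : X} (hy : y ∈ S) {c : ℝ}
    (h : radialSub (fun x => ((f x : ℝ) : EReal)) y v < (c : EReal)) :
    ∃ᶠ t in 𝓝[>] (0 : ℝ), (f (y + t • u) - f y) * t⁻¹ < c + K * ‖u - v‖ := by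
  have hmem : ∀ w : X, ∀ᶠ t in 𝓝[>] (0 : ℝ), y + t • w ∈ S := fun w => by
    have hw : Tendsto (fun t : ℝ => y + t • w) (𝓝 0) (𝓝 (y + (0 : ℝ) • w)) :=
      (by fun_prop : Continuous fun t : ℝ => y + t • w).tendsto 0
    rw [zero_smul, add_zero] at hw
    exact (hw.mono_left nhdsWithin_le_nhds).eventually (hS.mem_nhds hy)
  have hfreq := frequently_lt_of_liminf_lt (by isBoundedDefault) h
  refine (hfreq.and_eventually ((hmem u).and ((hmem v).and self_mem_nhdsWithin))).mono ?_
  rintro t ⟨hlt, hu, hv, ht⟩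
  rw [erSlope_coe, EReal.coe_lt_coe_iff] at hlt
  have ht : 0 < t := ht
  have hlip := hf.dist_le_mul _ hu _ hv
  rw [Real.dist_eq, dist_eq_norm, add_sub_add_left_eq_sub, ← smul_sub, norm_smul,
    Real.norm_of_nonneg ht.le] at hlip
  have hle := (le_abs_self _).trans hlip
  rw [← div_eq_mul_inv, div_lt_iff₀ ht] at hlt ⊢
  nlinarith

theorem clarkeSub_le_ptLimsup {X : Type*} [NormedAddCommGroup X] [NormedSpace ℝ X]
    {f : X → ℝ} {x : X} {ε : ℝ} (hε : 0 < ε) {K : NNReal}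
    (hf : LipschitzOnWith K f (Metric.ball x ε)) {u : X} (hu : u ≠ 0) {α : ℝ} (hα : 0 ≤ α) :
    clarkeSub (fun x => ((f x : ℝ) : EReal)) x u ≤
      ptLimsup (fun y => radialSub (fun x => ((f x : ℝ) : EReal)) y (u + α • (x - y))) x := by
  by_contra! hlt
  obtain ⟨c', hc, hc'⟩ := EReal.lt_iff_exists_real_btwn.1 hlt
  obtain ⟨c, hc, hcc'⟩ := EReal.lt_iff_exists_real_btwn.1 hc
  rw [EReal.coe_lt_coe_iff] at hcc'
  refine hc'.not_ge ?_
  simp only [ptLimsup, iInf_lt_iff] at hc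
  obtain ⟨δ, hδ, hc⟩ := hc
  have hδ : 0 < δ := hδ
  have hKα : 0 < K * α + 1 := by positivity
  obtain ⟨ρ, hρ, hρ'⟩ : ∃ ρ, 0 < ρ ∧ ρ ≤ min (min ε δ) ((c' - c) / (K * α + 1)) :=
    ⟨_, lt_min (lt_min hε hδ) (div_pos (sub_pos.2 hcc') hKα), le_rfl⟩
  simp only [le_min_iff, le_div_iff₀ hKα] at hρ'
  obtain ⟨⟨hρε, hρδ⟩, hρc⟩ := hρ'
  have hslope : ∀ y ∈ Metric.ball x ρ, y ≠ x →
      ∃ᶠ t in 𝓝[>] (0 : ℝ), (f (y + t • u) - f y) * t⁻¹ < c' := by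
    intro y hy hyx
    rw [mem_ball_iff_norm] at hy
    have hry : radialSub (fun x => ((f x : ℝ) : EReal)) y (u + α • (x - y)) < (c : EReal) :=
      (le_iSup₂ (f := fun y (_ : y ∈ {y : X | 0 < ‖y - x‖ ∧ ‖y - x‖ < δ}) =>
        radialSub (fun x => ((f x : ℝ) : EReal)) y (u + α • (x - y))) y
        ⟨norm_pos_iff.2 (sub_ne_zero.2 hyx), hy.trans_le hρδ⟩).trans_lt hc
    refine (frequently_slope_lt_of_radialSub_lt Metric.isOpen_ball hf
      (mem_ball_iff_norm.2 (hy.trans_le hρε)) (u := u) hry).mono fun t ht => ht.trans_le ?_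
    rw [sub_add_cancel_left, norm_neg, norm_smul, Real.norm_of_nonneg hα, norm_sub_rev]
    have : K * α * ‖y - x‖ ≤ K * α * ρ := by gcongr
    nlinarith
  rw [clarkeSub_eq_limsup_erSlope]
  refine limsup_le_of_le (by isBoundedDefault) ?_
  have hu' : 0 < ‖u‖ := norm_pos_iff.2 hu
  filter_upwards [prod_mem_prod (Metric.ball_mem_nhds x (half_pos hρ))
    (Ioo_mem_nhdsGT (div_pos (half_pos hρ) hu'))]
  rintro ⟨y, t⟩ ⟨hy, ht, htu⟩
  simp only [mem_ball_iff_norm] at hy ht htu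
  rw [lt_div_iff₀ hu'] at htu
  rw [erSlope_coe, EReal.coe_le_coe_iff]
  have hseg : ∀ s ∈ Icc 0 t, y + s • u ∈ Metric.ball x ρ := by
    intro s hs
    rw [mem_ball_iff_norm, add_sub_right_comm]
    refine (norm_add_le _ _).trans_lt ?_
    rw [norm_smul, Real.norm_of_nonneg hs.1]
    have : s * ‖u‖ ≤ t * ‖u‖ := by gcongr; exact hs.2
    linarith
  have hcont : ContinuousOn (fun s : ℝ => f (y + s • u)) (Icc 0 t) :=
    hf.continuousOn.comp (by fun_prop) fun s hs => Metric.ball_subset_ball hρε (hseg s hs)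
  obtain ⟨p, hp⟩ : ∃ p : ℝ, ∀ s : ℝ, s ≠ p → y + s • u ≠ x := by
    by_cases h : ∃ p : ℝ, y + p • u = x
    · obtain ⟨p, hp⟩ := h
      refine ⟨p, fun s hs hsx => hs (smul_left_injective ℝ hu ?_)⟩
      exact add_left_cancel (hsx.trans hp.symm)
    · exact ⟨0, fun s _ hs => h ⟨s, hs⟩⟩
  have hmain := sub_le_mul_of_frequently_slope_lt_of_ne (p := p) (c := c') ht.le hcont
    fun s hs hsp => by
      simpa only [add_smul, add_assoc] using
        hslope _ (hseg s (Ioo_subset_Icc_self hs)) (hp s hsp)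
  rw [← div_eq_mul_inv, div_le_iff₀ ht]
  simpa using hmain

theorem radialSub_zero {X : Type*} [NormedAddCommGroup X] [NormedSpace ℝ X] (f : X → ℝ) (x : X) :
    radialSub (fun x => ((f x : ℝ) : EReal)) x 0 = 0 := by
  have h : erSlope (fun x => ((f x : ℝ) : EReal)) x 0 = fun _ => 0 := by
    ext t; simp [erSlope_coe]
  rw [radialSub, h, liminf_const]

theorem clarkeSub_zero {X : Type*} [NormedAddCommGroup X] [NormedSpace ℝ X] (f : X → ℝ) (x : X) :
    clarkeSub (fun x => ((f x : ℝ) : EReal)) x 0 = 0 := by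
  simp [clarkeSub_eq_limsup_erSlope, erSlope_coe]

/-- For `f` Lipschitz near `xbar`, strict upper semismoothness at `xbar` in the direction `u`
is equivalent to `f^r(xbar;u) = f^0(xbar;u)`. -/
theorem lipschitz_strict_upper_semismooth_iff
    {X : Type*} [NormedAddCommGroup X] [NormedSpace ℝ X] [CompleteSpace X]
    (f : X → ℝ) (xbar : X)
    (hf : ∃ ε : ℝ, 0 < ε ∧ ∃ K : NNReal, LipschitzOnWith K f (Metric.ball xbar ε))
    (u : X) :
    StrictUpperSemismooth (fun x => ((f x : ℝ) : EReal)) xbar u ↔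
      radialSub (fun x => ((f x : ℝ) : EReal)) xbar u
        = clarkeSub (fun x => ((f x : ℝ) : EReal)) xbar u := by
  constructor
  · intro h
    rcases eq_or_ne u 0 with rfl | hu
    · rw [radialSub_zero, clarkeSub_zero]
    · obtain ⟨ε, hε, K, hK⟩ := hf
      refine le_antisymm (radialSub_le_clarkeSub _ _ _) (le_trans ?_ h)
      exact le_iInf₂ fun α hα => clarkeSub_le_ptLimsup hε hK hu hα
  · intro h
    refine iInf₂_le_of_le 0 self_mem_Ici ?_
    rw [h]
    simpa using ptLimsup_radialSub_le_clarkeSub (fun x => ((f x : ℝ) : EReal)) xbar u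
end

section
/- Let X be a real Banach space, let f : X → (−∞,+∞] be proper lower semicontinuous and convex, let x̄ ∈ dom f and u ∈ X with u ≠ 0 and x̄ + u ∈ dom f. Then f is strictly upper semismooth at x̄ in the direction u. -/
open Filter Topology Set

/-- A function with a real value at `y` is dominated along a segment ending at a real value by the
corresponding chord, so that its radial subderivative is at most the slope of this chord. -/
theorem ERealConvexOn.radialSub_le_of_coe {X : Type*} [NormedAddCommGroup X] [NormedSpace ℝ X]
    {f : X → EReal} (hconv : ERealConvexOn f) (hbot : ∀ x, f x ≠ ⊥) {y w : X} {t r c : ℝ}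
    (ht : 0 < t) (hr : f y = r) (hc : f (y + t • w) = c) :
    radialSub f y w ≤ (((c - r) * t⁻¹ : ℝ) : EReal) := by
  refine Filter.liminf_le_of_frequently_le' (Filter.Eventually.frequently ?_)
  filter_upwards [Ioo_mem_nhdsGT ht] with s hs
  have hs0 : 0 < s := hs.1
  have hst : s / t ≤ 1 := (div_le_one ht).2 hs.2.le
  have hle := hconv y (y + t • w) (1 - s / t) (s / t) (by linarith) (by positivity) (by ring)
  have hpt : (1 - s / t) • y + (s / t) • (y + t • w) = y + s • w := by
    rw [smul_add, smul_smul, div_mul_cancel₀ s ht.ne', ← add_assoc, ← add_smul]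
    simp
  rw [hpt, hr, hc] at hle
  norm_cast at hle
  have htop : f (y + s • w) ≠ ⊤ := ne_top_of_le_ne_top (EReal.coe_ne_top _) hle
  obtain ⟨v, hv⟩ : ∃ v : ℝ, f (y + s • w) = v :=
    ⟨_, (EReal.coe_toReal htop (hbot _)).symm⟩
  rw [hv] at hle
  unfold erSlope
  rw [hv, hr]
  norm_cast at hle ⊢
  rw [← div_eq_mul_inv, div_le_iff₀ hs0]
  have : (c - r) * t⁻¹ * s = s / t * (c - r) := by ring
  linarith

/-- The radial subderivative is `⊥` outside the effective domain. -/
theorem radialSub_eq_bot_of_eq_top {X : Type*} [NormedAddCommGroup X] [NormedSpace ℝ X]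
    {f : X → EReal} {y : X} (hy : f y = ⊤) (w : X) : radialSub f y w = ⊥ := by
  refine le_bot_iff.1 (Filter.liminf_le_of_frequently_le' (Filter.Eventually.frequently ?_))
  filter_upwards [self_mem_nhdsWithin] with s hs
  rw [erSlope, hy, EReal.sub_top, EReal.bot_mul_coe_of_pos (inv_pos.2 hs)]

/-- A proper lsc convex function is strictly upper semismooth. -/
theorem convex_strict_upper_semismooth
    {X : Type*} [NormedAddCommGroup X] [NormedSpace ℝ X] [CompleteSpace X]
    (f : X → EReal) (hf : ProperLsc f) (hconv : ERealConvexOn f)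
    (xbar : X) (hxbar : f xbar ≠ ⊤) (u : X) (hu : u ≠ 0) (hxu : f (xbar + u) ≠ ⊤) :
    StrictUpperSemismooth f xbar u := by
  obtain ⟨hlsc, -, hbot⟩ := hf
  obtain ⟨r₀, hr₀⟩ : ∃ v : ℝ, f xbar = v := ⟨_, (EReal.coe_toReal hxbar (hbot _)).symm⟩
  obtain ⟨r₁, hr₁⟩ : ∃ v : ℝ, f (xbar + u) = v := ⟨_, (EReal.coe_toReal hxu (hbot _)).symm⟩
  refine Filter.le_liminf_of_le (by isBoundedDefault) ?_
  filter_upwards [Ioo_mem_nhdsGT (zero_lt_one (α := ℝ))] with t ht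
  have ht0 : 0 < t := ht.1
  have hle := hconv xbar (xbar + u) (1 - t) t (by linarith [ht.2]) ht0.le (by ring)
  have hpt : (1 - t) • xbar + t • (xbar + u) = xbar + t • u := by
    rw [smul_add, ← add_assoc, ← add_smul]
    simp
  rw [hpt, hr₀, hr₁] at hle
  norm_cast at hle
  obtain ⟨c, hc⟩ : ∃ v : ℝ, f (xbar + t • u) = v :=
    ⟨_, (EReal.coe_toReal (ne_top_of_le_ne_top (EReal.coe_ne_top _) hle) (hbot _)).symm⟩
  refine (iInf₂_le t⁻¹ (inv_pos.2 ht0).le).trans ?_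
  rw [erSlope, hc, hr₀]
  norm_cast
  refine EReal.le_of_forall_lt_iff_le.1 fun z hz => ?_
  have hz' : (c - r₀) * t⁻¹ < z := by exact_mod_cast hz
  have hlt : ((c - z * t : ℝ) : EReal) < f xbar := by
    rw [hr₀]
    rw [← div_eq_mul_inv, div_lt_iff₀ ht0] at hz'
    exact_mod_cast (by linarith : c - z * t < r₀)
  obtain ⟨δ, hδ, hball⟩ := Metric.eventually_nhds_iff.1 (hlsc xbar _ hlt)
  refine (iInf₂_le δ hδ).trans (iSup₂_le fun y hy => ?_)
  by_cases hy_top : f y = ⊤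
  · simp [radialSub_eq_bot_of_eq_top hy_top]
  obtain ⟨r, hr⟩ : ∃ v : ℝ, f y = v := ⟨_, (EReal.coe_toReal hy_top (hbot _)).symm⟩
  have hend : y + t • (u + t⁻¹ • (xbar - y)) = xbar + t • u := by
    rw [smul_add, smul_inv_smul₀ ht0.ne']
    abel
  refine (hconv.radialSub_le_of_coe hbot ht0 hr (hend ▸ hc)).trans ?_
  have hlow : ((c - z * t : ℝ) : EReal) < f y := hball (by rw [dist_eq_norm]; exact hy.2)
  rw [hr] at hlow
  norm_cast at hlow ⊢
  rw [← div_eq_mul_inv, div_le_iff₀ ht0]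
  linarith
end

section
/- Let X be a real Banach space, let f : X → (−∞,+∞] be proper lower semicontinuous, let x̄ ∈ dom f and u ∈ X with u ≠ 0 and x̄ + u ∈ dom f. If f is directionally approximately convex at x̄, then f is strictly upper semismooth at x̄ in the direction u. -/
open Filter Topology Set

/-- `f` is directionally approximately convex at `xbar`. -/
def DirApproxConvexAt {X : Type*} [NormedAddCommGroup X] [NormedSpace ℝ X]
    (f : X → EReal) (xbar : X) : Prop :=
  ∀ u : X, ‖u‖ = 1 → ∀ ε : ℝ, 0 < ε → ∃ δ : ℝ, 0 < δ ∧
    ∀ x ∈ Metric.ball xbar δ, ∀ y ∈ Metric.ball xbar δ, x ≠ y →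
      ‖x - y‖⁻¹ • (x - y) ∈ Metric.ball u δ →
      ∀ t ∈ Set.Icc (0:ℝ) 1,
        f (t • x + (1 - t) • y)
          ≤ (t : EReal) * f x + ((1 - t : ℝ) : EReal) * f y
            + ((ε * (t * (1 - t)) * ‖x - y‖ : ℝ) : EReal)

/-- A point with a small difference quotient at `x` has a small value. -/
theorem exists_real_of_erSlope_lt {X : Type*} [NormedAddCommGroup X] [NormedSpace ℝ X]
    {f : X → EReal} {x u : X} {b t m : ℝ} (hb : f x = b) (hbot : f (x + t • u) ≠ ⊥)
    (ht : 0 < t) (h : erSlope f x u t < m) :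
    ∃ c : ℝ, f (x + t • u) = c ∧ c < b + m * t := by
  unfold erSlope at h
  rw [hb] at h
  generalize f (x + t • u) = z at *
  induction z with
  | bot => exact absurd rfl hbot
  | top =>
    rw [EReal.top_sub_coe, EReal.top_mul_coe_of_pos (inv_pos.2 ht)] at h
    exact absurd h not_top_lt
  | coe c =>
    refine ⟨c, rfl, ?_⟩
    have h' : (c - b) * t⁻¹ < m := by exact_mod_cast h
    rw [← div_eq_mul_inv, div_lt_iff₀ ht] at h'
    linarith

/-- Approximate convexity along the segment from `x` to `z` bounds the radial subderivative of `f`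
at `x` in the direction `r⁻¹ • (z - x)`. -/
theorem radialSub_le_of_approxConvex_segment {X : Type*} [NormedAddCommGroup X] [NormedSpace ℝ X]
    {f : X → EReal} {x z : X} {a c e l r : ℝ} (ha : f x = a) (he : 0 ≤ e)
    (hr : 0 < r) (hl : c - a + e ≤ l * r)
    (hconv : ∀ s ∈ Icc (0 : ℝ) 1, f (s • z + (1 - s) • x) ≤
      ((s * c + (1 - s) * a + e * (s * (1 - s)) : ℝ) : EReal)) :
    radialSub f x (r⁻¹ • (z - x)) ≤ l := by
  have hev : ∀ᶠ t in 𝓝[>] (0 : ℝ), erSlope f x (r⁻¹ • (z - x)) t ≤ l := by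
    filter_upwards [Ioo_mem_nhdsGT hr] with t ht
    have hs0 : 0 < t / r := div_pos ht.1 hr
    have hs1 : t / r < 1 := (div_lt_one hr).2 ht.2
    have hpt : x + t • r⁻¹ • (z - x) = (t / r) • z + (1 - t / r) • x := by
      rw [smul_smul, ← div_eq_mul_inv]
      module
    have hreal : (t / r * c + (1 - t / r) * a + e * (t / r * (1 - t / r)) - a) * t⁻¹ ≤ l := by
      have heq : (t / r * c + (1 - t / r) * a + e * (t / r * (1 - t / r)) - a) * t⁻¹
          = (c - a + e * (1 - t / r)) / r := by
        have := ht.1.ne'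
        field_simp
        ring
      rw [heq, div_le_iff₀ hr]
      nlinarith [mul_nonneg he hs0.le]
    have hmono := mul_le_mul_of_nonneg_right
      (EReal.sub_le_sub (hconv _ ⟨hs0.le, hs1.le⟩) (le_refl (a : EReal)))
      (EReal.coe_nonneg.2 (inv_nonneg.2 ht.1.le))
    unfold erSlope
    rw [hpt, ha]
    exact hmono.trans (by exact_mod_cast hreal)
  exact liminf_le_of_frequently_le' hev.frequently

/-- The radial subderivative is `⊥` outside the effective domain. -/
theorem radialSub_eq_bot {X : Type*} [NormedAddCommGroup X] [NormedSpace ℝ X]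
    {f : X → EReal} {x : X} (hx : f x = ⊤) (w : X) : radialSub f x w = ⊥ := by
  refine le_bot_iff.1 (liminf_le_of_frequently_le' (Eventually.frequently ?_))
  filter_upwards [self_mem_nhdsWithin] with t ht
  unfold erSlope
  rw [hx, EReal.sub_top, EReal.bot_mul_coe_of_pos (inv_pos.2 ht)]

/-- The limsup of `h` at `x` is bounded by any eventual bound for `h` near `x`. -/
theorem ptLimsup_le_of_eventually {X : Type*} [NormedAddCommGroup X]
    {h : X → EReal} {x : X} {l : EReal} (hev : ∀ᶠ y in 𝓝 x, h y ≤ l) : ptLimsup h x ≤ l := by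
  obtain ⟨d, hd, hball⟩ := Metric.eventually_nhds_iff.1 hev
  exact (iInf₂_le d hd).trans (iSup₂_le fun y hy ↦ hball (by rw [dist_eq_norm]; exact hy.2))

/-- A directionally approximately convex function is strictly upper semismooth. -/
theorem dirApproxConvex_strict_upper_semismooth
    {X : Type*} [NormedAddCommGroup X] [NormedSpace ℝ X] [CompleteSpace X]
    (f : X → EReal) (hf : ProperLsc f) (xbar : X) (hxbar : f xbar ≠ ⊤)
    (u : X) (hu : u ≠ 0) (hxu : f (xbar + u) ≠ ⊤)
    (hdac : DirApproxConvexAt f xbar) :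
    StrictUpperSemismooth f xbar u := by
  unfold StrictUpperSemismooth
  obtain ⟨b, hb⟩ : ∃ b : ℝ, f xbar = b :=
    ⟨_, (EReal.coe_toReal hxbar (hf.2.2 xbar)).symm⟩
  refine EReal.le_of_forall_lt_iff_le.1 fun l hl ↦ ?_
  obtain ⟨m, hm, hml⟩ := EReal.lt_iff_exists_real_btwn.1 hl
  replace hml : m < l := by exact_mod_cast hml
  have hu0 : 0 < ‖u‖ := norm_pos_iff.2 hu
  set ε := (l - m) / (4 * ‖u‖) with hε
  have hε0 : 0 < ε := by have := sub_pos.2 hml; positivity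
  obtain ⟨δ, hδ, hconv⟩ := hdac (‖u‖⁻¹ • u)
    (by rw [norm_smul, norm_inv, norm_norm, inv_mul_cancel₀ hu0.ne']) ε hε0
  obtain ⟨t, hslope, ht0, htδ⟩ :=
    ((frequently_lt_of_liminf_lt (by isBoundedDefault) hm).and_eventually
      (Ioo_mem_nhdsGT (div_pos hδ hu0))).exists
  rw [lt_div_iff₀ hu0] at htδ
  obtain ⟨c, hc, hcb⟩ := exists_real_of_erSlope_lt hb (hf.2.2 _) ht0 hslope
  set z := xbar + t • u with hz
  have hzsub : z - xbar = t • u := by simp [hz]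
  have hznorm : ‖z - xbar‖ = t * ‖u‖ := by rw [hzsub, norm_smul, Real.norm_of_nonneg ht0.le]
  have hzne : ‖z - xbar‖ ≠ 0 := by rw [hznorm]; positivity
  refine (iInf₂_le t⁻¹ (inv_nonneg.2 ht0.le)).trans (ptLimsup_le_of_eventually ?_)
  have hcont : ContinuousAt (fun y ↦ ‖z - y‖) xbar := by fun_prop
  have hdir : ContinuousAt (fun y ↦ ‖z - y‖⁻¹ • (z - y)) xbar :=
    (hcont.inv₀ hzne).smul (by fun_prop)
  have hdir0 : ‖z - xbar‖⁻¹ • (z - xbar) = ‖u‖⁻¹ • u := by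
    rw [hznorm, hzsub, smul_smul]
    congr 1
    field_simp
  have hdirball : ∀ᶠ y in 𝓝 xbar, ‖z - y‖⁻¹ • (z - y) ∈ Metric.ball (‖u‖⁻¹ • u) δ :=
    hdir.eventually_mem (by rw [hdir0]; exact Metric.ball_mem_nhds _ hδ)
  have hdist : ∀ᶠ y in 𝓝 xbar, ‖z - y‖ < 2 * (t * ‖u‖) :=
    hcont.eventually_lt_const (by beta_reduce; rw [hznorm]; linarith [mul_pos ht0 hu0])
  have hlsc : ∀ᶠ y in 𝓝 xbar, ((b - t * (l - m) / 2 : ℝ) : EReal) < f y := by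
    refine hf.1 xbar _ ?_
    beta_reduce
    rw [hb, gt_iff_lt, EReal.coe_lt_coe_iff]
    linarith [mul_pos ht0 (sub_pos.2 hml)]
  filter_upwards [hdirball, hdist, hlsc, Metric.ball_mem_nhds xbar hδ,
    hcont.eventually_ne hzne] with y hy1 hy2 hy3 hy4 hy5
  by_cases hytop : f y = ⊤
  · rw [radialSub_eq_bot hytop]
    exact bot_le
  obtain ⟨a, ha⟩ : ∃ a : ℝ, f y = a := ⟨_, (EReal.coe_toReal hytop (hf.2.2 y)).symm⟩
  rw [ha, EReal.coe_lt_coe_iff] at hy3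
  have hw : u + t⁻¹ • (xbar - y) = t⁻¹ • (z - y) := by
    rw [hz, add_sub_right_comm, smul_add, smul_smul, inv_mul_cancel₀ ht0.ne', one_smul, add_comm]
  rw [hw]
  refine radialSub_le_of_approxConvex_segment ha (c := c) (e := ε * ‖z - y‖) (by positivity) ht0 ?_ ?_
  · have h1 : ε * ‖z - y‖ ≤ ε * (2 * (t * ‖u‖)) := mul_le_mul_of_nonneg_left hy2.le hε0.le
    have h2 : ε * (2 * (t * ‖u‖)) = t * (l - m) / 2 := by
      rw [hε]
      field_simp
      ring
    linarith
  · intro s hs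
    have hzy : z ≠ y := fun h ↦ hy5 (by simp [h])
    have hzball : z ∈ Metric.ball xbar δ := by rwa [Metric.mem_ball, dist_eq_norm, hznorm]
    refine (hconv z hzball y hy4 hzy hy1 s hs).trans (le_of_eq ?_)
    rw [ha, hc]
    norm_cast
    ring_nf
end

section
/- Let X be a real Banach space, let f : X → ℝ be locally Lipschitz, let x̄ ∈ X and u ∈ X with u ≠ 0. If f is semismooth at x̄ in the sense of Mifflin, then f is upper semismooth at x̄ in the direction u; more precisely, limsup_{x→_u x̄} f^r(x; u) ≤ f^r(x̄;u). -/
open Filter Topology Set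

/-- `f` is semismooth at `xbar` in the sense of Mifflin: for every `v` and every sequence
`(xₙ, xₙ*)` in the Clarke subdifferential with `xₙ →_v xbar`, one has `⟨xₙ*, v⟩ → f^r(xbar;v)`. -/
def MifflinSemismooth {X : Type*} [NormedAddCommGroup X] [NormedSpace ℝ X]
    (f : X → EReal) (xbar : X) : Prop :=
  ∀ v : X, ∀ (xs : ℕ → X) (ps : ℕ → X →L[ℝ] ℝ) (ts : ℕ → ℝ) (vs : ℕ → X),
    (∀ n, ps n ∈ clarkeSubdiff f (xs n)) →
    (∀ n, 0 < ts n) → Filter.Tendsto ts atTop (𝓝 0) →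
    Filter.Tendsto vs atTop (𝓝 v) →
    (∀ n, xs n = xbar + ts n • vs n) →
    Filter.Tendsto (fun n => (((ps n) v : ℝ) : EReal)) atTop (𝓝 (radialSub f xbar v))

section ClarkeDerivative

variable {X : Type*} [NormedAddCommGroup X] [NormedSpace ℝ X]

/-- The difference quotient `(f(x + t·v) − f(x))/t` of a real-valued function, as a function of the
pair `(x, t)`. -/
noncomputable def diffQuot (f : X → ℝ) (v : X) (p : X × ℝ) : ℝ :=
  (f (p.1 + p.2 • v) - f p.1) * p.2⁻¹

/-- The Clarke derivative `f⁰(y;v)` of a real-valued function, as a real number. -/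
noncomputable def clarkeDeriv (f : X → ℝ) (y v : X) : ℝ :=
  limsup (diffQuot f v) (𝓝 y ×ˢ 𝓝[>] (0 : ℝ))

lemma tendsto_fst_add_snd_smul (y v : X) :
    Tendsto (fun p : X × ℝ => p.1 + p.2 • v) (𝓝 y ×ˢ 𝓝[>] (0 : ℝ)) (𝓝 y) := by
  have h : Tendsto (fun p : X × ℝ => p.1 + p.2 • v) (𝓝 (y, (0 : ℝ))) (𝓝 (y + (0 : ℝ) • v)) :=
    Continuous.tendsto (by fun_prop) (y, (0 : ℝ))
  rw [zero_smul, add_zero, nhds_prod_eq] at h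
  exact h.mono_left (prod_mono le_rfl nhdsWithin_le_nhds)

lemma eventually_snd_pos {Y : Type*} [TopologicalSpace Y] (y : Y) :
    ∀ᶠ p : Y × ℝ in 𝓝 y ×ˢ 𝓝[>] (0 : ℝ), 0 < p.2 :=
  tendsto_snd.eventually (eventually_mem_nhdsWithin (a := (0 : ℝ)) (s := Ioi 0))

lemma abs_diffQuot_sub_le {f : X → ℝ} {K : NNReal} {s : Set X} (hK : LipschitzOnWith K f s)
    {p : X × ℝ} {v w : X} (ht : 0 < p.2) (hv : p.1 + p.2 • v ∈ s) (hw : p.1 + p.2 • w ∈ s) :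
    |diffQuot f v p - diffQuot f w p| ≤ K * ‖v - w‖ := by
  have h := hK.dist_le_mul _ hv _ hw
  rw [Real.dist_eq, dist_eq_norm, add_sub_add_left_eq_sub, ← smul_sub, norm_smul,
    Real.norm_of_nonneg ht.le] at h
  rw [diffQuot, diffQuot, ← sub_mul, sub_sub_sub_cancel_right, abs_mul, abs_of_pos (inv_pos.2 ht),
    ← div_eq_mul_inv, div_le_iff₀ ht]
  linarith

lemma exists_eventually_abs_diffQuot_le {f : X → ℝ} (hf : LocallyLipschitz f) (y : X) :
    ∃ K : NNReal, ∀ v : X, ∀ᶠ p in 𝓝 y ×ˢ 𝓝[>] (0 : ℝ), |diffQuot f v p| ≤ K * ‖v‖ := by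
  obtain ⟨K, s, hs, hK⟩ := hf y
  refine ⟨K, fun v => ?_⟩
  filter_upwards [eventually_snd_pos y, tendsto_fst_add_snd_smul y v hs,
    tendsto_fst_add_snd_smul y 0 hs] with p ht hv h0
  simpa [diffQuot] using abs_diffQuot_sub_le hK ht hv h0

lemma isBoundedUnder_le_diffQuot {f : X → ℝ} (hf : LocallyLipschitz f) (y : X) (v : X) :
    IsBoundedUnder (· ≤ ·) (𝓝 y ×ˢ 𝓝[>] (0 : ℝ)) (diffQuot f v) := by
  obtain ⟨K, hK⟩ := exists_eventually_abs_diffQuot_le hf y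
  exact ⟨K * ‖v‖, (hK v).mono fun p hp => (abs_le.1 hp).2⟩

lemma isCoboundedUnder_le_diffQuot {f : X → ℝ} (hf : LocallyLipschitz f) (y : X) (v : X) :
    IsCoboundedUnder (· ≤ ·) (𝓝 y ×ˢ 𝓝[>] (0 : ℝ)) (diffQuot f v) := by
  obtain ⟨K, hK⟩ := exists_eventually_abs_diffQuot_le hf y
  exact IsBoundedUnder.isCoboundedUnder_flip
    ⟨-(K * ‖v‖), (hK v).mono fun p hp => (abs_le.1 hp).1⟩

lemma exists_clarkeDeriv_le_mul_norm {f : X → ℝ} (hf : LocallyLipschitz f) (y : X) :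
    ∃ K : ℝ, ∀ v : X, clarkeDeriv f y v ≤ K * ‖v‖ := by
  obtain ⟨K, hK⟩ := exists_eventually_abs_diffQuot_le hf y
  exact ⟨K, fun v => limsup_le_of_le (isCoboundedUnder_le_diffQuot hf y v)
    ((hK v).mono fun p hp => (abs_le.1 hp).2)⟩

lemma eventually_diffQuot_lt {f : X → ℝ} (hf : LocallyLipschitz f) (y : X)
    {v : X} {c : ℝ} (h : clarkeDeriv f y v < c) :
    ∀ᶠ p in 𝓝 y ×ˢ 𝓝[>] (0 : ℝ), diffQuot f v p < c :=
  eventually_lt_of_limsup_lt h (isBoundedUnder_le_diffQuot hf y v)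

lemma clarkeDeriv_add_le {f : X → ℝ} (hf : LocallyLipschitz f) (y : X) (v w : X) :
    clarkeDeriv f y (v + w) ≤ clarkeDeriv f y v + clarkeDeriv f y w := by
  refine le_of_forall_pos_le_add fun ε hε => ?_
  refine limsup_le_of_le (isCoboundedUnder_le_diffQuot hf y _) ?_
  have hT : Tendsto (fun p : X × ℝ => (p.1 + p.2 • w, p.2)) (𝓝 y ×ˢ 𝓝[>] (0 : ℝ))
      (𝓝 y ×ˢ 𝓝[>] (0 : ℝ)) := (tendsto_fst_add_snd_smul y w).prodMk tendsto_snd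
  filter_upwards [hT.eventually (eventually_diffQuot_lt hf y (v := v)
    (lt_add_of_pos_right _ (half_pos hε))),
    eventually_diffQuot_lt hf y (v := w) (lt_add_of_pos_right _ (half_pos hε))] with p hv hw
  have : diffQuot f (v + w) p = diffQuot f v (p.1 + p.2 • w, p.2) + diffQuot f w p := by
    simp only [diffQuot, smul_add, add_assoc, add_comm (p.2 • w)]
    ring
  linarith

lemma clarkeDeriv_smul_le {f : X → ℝ} (hf : LocallyLipschitz f) (y : X)
    {c : ℝ} (hc : 0 < c) (v : X) :
    clarkeDeriv f y (c • v) ≤ c * clarkeDeriv f y v := by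
  refine le_of_forall_pos_le_add fun ε hε => ?_
  refine limsup_le_of_le (isCoboundedUnder_le_diffQuot hf y _) ?_
  have hmul : Tendsto (fun t : ℝ => t * c) (𝓝[>] 0) (𝓝[>] 0) := by
    refine tendsto_nhdsWithin_iff.2 ⟨?_, ?_⟩
    · have h : Tendsto (fun t : ℝ => t * c) (𝓝 0) (𝓝 (0 * c)) :=
        Continuous.tendsto (by fun_prop) 0
      rw [zero_mul] at h
      exact h.mono_left nhdsWithin_le_nhds
    · filter_upwards [self_mem_nhdsWithin] with t ht using mul_pos ht hc
  have hT : Tendsto (fun p : X × ℝ => (p.1, p.2 * c)) (𝓝 y ×ˢ 𝓝[>] (0 : ℝ))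
      (𝓝 y ×ˢ 𝓝[>] (0 : ℝ)) := tendsto_fst.prodMk (hmul.comp tendsto_snd)
  filter_upwards [hT.eventually
    (eventually_diffQuot_lt hf y (v := v) (lt_add_of_pos_right _ (div_pos hε hc)))] with p hv
  have h : diffQuot f (c • v) p = c * diffQuot f v (p.1, p.2 * c) := by
    simp only [diffQuot, smul_smul, mul_inv]
    field_simp
  rw [h]
  calc c * diffQuot f v (p.1, p.2 * c) ≤ c * (clarkeDeriv f y v + ε / c) := by gcongr
    _ = c * clarkeDeriv f y v + ε := by field_simp

lemma clarkeDeriv_smul {f : X → ℝ} (hf : LocallyLipschitz f) (y : X)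
    {c : ℝ} (hc : 0 < c) (v : X) :
    clarkeDeriv f y (c • v) = c * clarkeDeriv f y v := by
  refine (clarkeDeriv_smul_le hf y hc v).antisymm ?_
  have h := clarkeDeriv_smul_le hf y (inv_pos.2 hc) (c • v)
  rwa [inv_smul_smul₀ hc.ne', ← div_eq_inv_mul, le_div_iff₀' hc] at h

lemma clarkeDeriv_le_crSub {f : X → ℝ} (hf : LocallyLipschitz f) (y : X) (v : X) :
    (clarkeDeriv f y v : EReal) ≤ crSub (fun x => (f x : EReal)) y v := by
  obtain ⟨K, s, hs, hK⟩ := hf y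
  obtain ⟨r, hr, hrs⟩ := Metric.mem_nhds_iff.1 hs
  refine EReal.ge_of_forall_gt_iff_ge.1 fun c hc => ?_
  obtain ⟨c', hc', hc'v⟩ := exists_between (EReal.coe_lt_coe_iff.1 hc)
  obtain ⟨δ, hδ, hKδ⟩ : ∃ δ : ℝ, 0 < δ ∧ K * δ < c' - c :=
    exists_pos_mul_lt (sub_pos.2 hc') (K : ℝ)
  have hcont : Continuous fun x => (f x : EReal) :=
    continuous_coe_real_ereal.comp hf.continuous
  have hnhds : 𝓝 y ⊓ comap (fun x => (f x : EReal)) (𝓝 (f y : EReal)) = 𝓝 y :=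
    inf_eq_left.2 (tendsto_iff_comap.1 (hcont.tendsto y))
  rw [crSub, hnhds]
  refine le_iSup₂_of_le δ hδ (le_limsup_of_frequently_le ?_)
  have hfreq : ∃ᶠ p in 𝓝 y ×ˢ 𝓝[>] (0 : ℝ), c' < diffQuot f v p :=
    frequently_lt_of_lt_limsup (isCoboundedUnder_le_diffQuot hf y v) hc'v
  have hsmall : ∀ᶠ p : X × ℝ in 𝓝 y ×ˢ 𝓝[>] (0 : ℝ), ∀ w ∈ Metric.ball v δ,
      p.1 + p.2 • w ∈ s := by
    have hlim : Tendsto (fun p : X × ℝ => ‖p.1 + p.2 • v - y‖ + p.2 * δ)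
        (𝓝 y ×ˢ 𝓝[>] (0 : ℝ)) (𝓝 (‖y - y‖ + 0 * δ)) :=
      ((tendsto_fst_add_snd_smul y v).sub_const y).norm.add
        ((tendsto_snd.mono_right nhdsWithin_le_nhds).mul_const δ)
    rw [sub_self, norm_zero, zero_mul, add_zero] at hlim
    filter_upwards [hlim.eventually (gt_mem_nhds hr), eventually_snd_pos y] with p hp ht w hw
    refine hrs (mem_ball_iff_norm.2 ?_)
    calc ‖p.1 + p.2 • w - y‖ = ‖(p.1 + p.2 • v - y) + p.2 • (w - v)‖ := by
          rw [smul_sub]; congr 1; abel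
      _ ≤ ‖p.1 + p.2 • v - y‖ + p.2 * ‖w - v‖ := by
          refine (norm_add_le _ _).trans_eq ?_
          rw [norm_smul, Real.norm_of_nonneg ht.le]
      _ ≤ ‖p.1 + p.2 • v - y‖ + p.2 * δ := by
          gcongr
          exact (mem_ball_iff_norm.1 hw).le
      _ < r := hp
  refine (hfreq.and_eventually (hsmall.and (eventually_snd_pos y))).mono ?_
  rintro p ⟨hp, hps, ht⟩
  refine le_iInf₂ fun w hw => ?_
  have h := abs_diffQuot_sub_le hK ht (hps v (Metric.mem_ball_self hδ)) (hps w hw)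
  have hvw : K * ‖v - w‖ ≤ K * δ := by
    gcongr
    exact (mem_ball_iff_norm'.1 hw).le
  have hcw : c ≤ diffQuot f w p := by linarith [(abs_le.1 h).2]
  simpa [diffQuot] using EReal.coe_le_coe_iff.2 hcw

lemma radialSub_le_clarkeDeriv {f : X → ℝ} (hf : LocallyLipschitz f) (y : X) (v : X) :
    radialSub (fun x => (f x : EReal)) y v ≤ clarkeDeriv f y v := by
  refine EReal.le_of_forall_lt_iff_le.1 fun c hc => ?_
  have hT : Tendsto (fun t : ℝ => (y, t)) (𝓝[>] 0) (𝓝 y ×ˢ 𝓝[>] 0) :=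
    tendsto_const_nhds.prodMk tendsto_id
  refine liminf_le_of_frequently_le (Eventually.frequently ?_)
  filter_upwards [hT.eventually (eventually_diffQuot_lt hf y (EReal.coe_lt_coe_iff.1 hc))]
    with t ht
  simpa [diffQuot, erSlope] using EReal.coe_le_coe_iff.2 ht.le

lemma exists_mem_clarkeSubdiff_apply_eq {f : X → ℝ} (hf : LocallyLipschitz f) (y : X)
    {u : X} (hu : u ≠ 0) :
    ∃ p ∈ clarkeSubdiff (fun x => (f x : EReal)) y, p u = clarkeDeriv f y u := by
  have h0 : clarkeDeriv f y 0 = 0 := by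
    have h : diffQuot f (0 : X) = fun _ => 0 := by
      ext p
      simp [diffQuot]
    rw [clarkeDeriv, h, limsup_const]
  let φ : X →ₗ.[ℝ] ℝ := LinearPMap.mkSpanSingleton u (clarkeDeriv f y u) hu
  obtain ⟨g, hg, hgN⟩ := exists_extension_of_le_sublinear φ (clarkeDeriv f y)
    (fun c hc v => clarkeDeriv_smul hf y hc v) (clarkeDeriv_add_le hf y) (by
      rintro ⟨x, hx⟩
      obtain ⟨c, rfl⟩ := Submodule.mem_span_singleton.1 hx
      refine (LinearPMap.mkSpanSingleton'_apply _ _ _ c hx).trans_le ?_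
      rw [RingHom.id_apply, smul_eq_mul]
      rcases lt_trichotomy c 0 with hc | rfl | hc
      · have h1 := clarkeDeriv_smul hf y (neg_pos.2 hc) u
        have h2 := clarkeDeriv_add_le hf y (c • u) (-c • u)
        rw [neg_smul, add_neg_cancel, h0, ← neg_smul] at h2
        linarith
      · simp [h0]
      · exact (clarkeDeriv_smul hf y hc u).ge)
  obtain ⟨K, hK⟩ := exists_clarkeDeriv_le_mul_norm hf y
  refine ⟨g.mkContinuous K fun v => abs_le.2 ⟨?_, (hgN v).trans (hK v)⟩, fun v => ?_, ?_⟩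
  · have := (hgN (-v)).trans (hK (-v))
    rw [map_neg, norm_neg] at this
    linarith
  · exact (EReal.coe_le_coe_iff.2 (hgN v)).trans (clarkeDeriv_le_crSub hf y v)
  · exact (hg ⟨u, Submodule.mem_span_singleton_self u⟩).trans
      (LinearPMap.mkSpanSingleton_apply ℝ ℝ hu _)

end ClarkeDerivative

/-- A locally Lipschitz Mifflin-semismooth function is upper semismooth. -/
theorem mifflin_semismooth_upper_semismooth
    {X : Type*} [NormedAddCommGroup X] [NormedSpace ℝ X] [CompleteSpace X]
    (f : X → ℝ) (hf : LocallyLipschitz f) (xbar u : X) (hu : u ≠ 0)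
    (hss : MifflinSemismooth (fun x => ((f x : ℝ) : EReal)) xbar) :
    dirLimsup (fun x => radialSub (fun y => ((f y : ℝ) : EReal)) x u) xbar u
        ≤ radialSub (fun x => ((f x : ℝ) : EReal)) xbar u ∧
    UpperSemismooth (fun x => ((f x : ℝ) : EReal)) xbar u := by
  have key : dirLimsup (fun x => radialSub (fun y => ((f y : ℝ) : EReal)) x u) xbar u
      ≤ radialSub (fun x => ((f x : ℝ) : EReal)) xbar u := by
    refine le_of_not_gt fun hlt => ?_
    obtain ⟨c, hrc, hc⟩ := EReal.lt_iff_exists_real_btwn.1 hlt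
    have hex : ∀ n : ℕ, ∃ (t : ℝ) (v : X) (p : X →L[ℝ] ℝ), 0 < t ∧ t < 1 / ((n : ℝ) + 1) ∧
        ‖v - u‖ < 1 / ((n : ℝ) + 1) ∧
        p ∈ clarkeSubdiff (fun x => (f x : EReal)) (xbar + t • v) ∧ (c : EReal) ≤ p u := by
      intro n
      have hn := hc.trans_le (iInf₂_le (1 / ((n : ℝ) + 1)) (mem_Ioi.2 Nat.one_div_pos_of_nat))
      simp only [lt_iSup_iff] at hn
      obtain ⟨t, ht, v, hv, hcv⟩ := hn
      obtain ⟨p, hp, hpu⟩ := exists_mem_clarkeSubdiff_apply_eq hf (xbar + t • v) hu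
      refine ⟨t, v, p, ht.1, ht.2, mem_ball_iff_norm.1 hv, hp, ?_⟩
      rw [hpu]
      exact hcv.le.trans (radialSub_le_clarkeDeriv hf _ u)
    choose ts vs ps hpos hts hvs hps hcu using hex
    have hlim := tendsto_one_div_add_atTop_nhds_zero_nat (𝕜 := ℝ)
    refine hrc.not_ge (ge_of_tendsto' (hss u (fun n => xbar + ts n • vs n) ps ts vs hps hpos ?_ ?_
      fun _ => rfl) hcu)
    · exact squeeze_zero (fun n => (hpos n).le) (fun n => (hts n).le) hlim
    · exact tendsto_iff_norm_sub_tendsto_zero.2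
        (squeeze_zero (fun n => norm_nonneg _) (fun n => (hvs n).le) hlim)
  refine ⟨key, iInf₂_le_of_le 0 (mem_Ici.2 le_rfl) ?_⟩
  simpa using key
end
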